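/- arXiv:1807.06383 — 12 statements merged into one kernel-verified Lean document; each statement's English description precedes it below -/
import Mathlib

section
/- Let k be an algebraically closed field of characteristic 0 and let A be a connected ℕ-graded k-algebra that is finitely generated, generated in degree 1, and quadratic (i.e. A ≅ T(A₁)/⟨R⟩ for a subspace R ⊆ A₁ ⊗ A₁ of homogeneous quadratic relations). Let τ = {τ_m : m ∈ ℕ} be a twisting system on A such that the graded linear isomorphism τ₁ is additionally an algebra automorphism of A, and set τ' = {τ₁^m : m ∈ ℕ}. Then the twisted algebras A^τ and A^{τ'} are isomorphic as graded k-algebras. -/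
/-- A twisting system on an ℕ-graded `k`-algebra with graded components `𝒜`: a family
`τ = {τ_n : n ∈ ℕ}` of degree-0 `k`-linear automorphisms satisfying
`τ_m(a·b) = τ_m(a)·τ_{m+n}(τ_n⁻¹(b))` for all `m, n ∈ ℕ`, all `a ∈ 𝒜 n` and all `b`. -/
structure TwistingSystem (k : Type*) {A : Type*} [CommSemiring k] [Semiring A]
    [Algebra k A] (𝒜 : ℕ → Submodule k A) where
  toFun : ℕ → (A ≃ₗ[k] A)
  map_mem : ∀ n m : ℕ, ∀ a ∈ 𝒜 m, toFun n a ∈ 𝒜 m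
  symm_map_mem : ∀ n m : ℕ, ∀ a ∈ 𝒜 m, (toFun n).symm a ∈ 𝒜 m
  twist : ∀ m n : ℕ, ∀ a b : A, a ∈ 𝒜 n →
    toFun m (a * b) = toFun m a * toFun (m + n) ((toFun n).symm b)

/-- Let `k` be an algebraically closed field of characteristic 0 and `A` a connected
ℕ-graded `k`-algebra which is finitely generated, generated in degree 1 and quadratic
(the kernel of the canonical surjection from the tensor algebra on `A₁` is generated as
a two-sided ideal by its degree-2 part).  Let `τ` be a twisting system on `A` such that
`τ₁` is additionally an algebra automorphism, and let `τ' = {τ₁^m : m ∈ ℕ}`.  Then the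
twisted algebras `A^τ` and `A^{τ'}` are isomorphic as graded `k`-algebras: there is a
degree-preserving `k`-linear equivalence `φ` of the underlying graded vector space `A`
sending the identity `τ₀⁻¹(1)` of `A^τ` to the identity `1` of `A^{τ'}` and satisfying
`φ(a ⋆_τ b) = φ(a) ⋆_{τ'} φ(b)`, i.e. `φ(a·τ_m(b)) = φ(a)·τ₁^m(φ(b))` for homogeneous
`a` of degree `m`. -/
theorem twisted_algebra_iso_algebraic_twist_of_tau_one_automorphism
    (k A : Type*) [Field k] [IsAlgClosed k] [CharZero k] [Ring A] [Algebra k A]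
    (𝒜 : ℕ → Submodule k A) [GradedAlgebra 𝒜]
    (hconn : 𝒜 0 = 1)
    [Module.Finite k (𝒜 1)]
    (hgen : Function.Surjective (TensorAlgebra.lift k ((𝒜 1).subtype)))
    (hquad : ∀ x : TensorAlgebra k (𝒜 1),
      TensorAlgebra.lift k ((𝒜 1).subtype) x = 0 ↔
        x ∈ TwoSidedIdeal.span {y : TensorAlgebra k (𝒜 1) |
          TensorAlgebra.lift k ((𝒜 1).subtype) y = 0 ∧
          y ∈ (LinearMap.range (TensorAlgebra.ι k : 𝒜 1 →ₗ[k] TensorAlgebra k (𝒜 1))) ^ 2})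
    (τ : TwistingSystem k 𝒜)
    (hτ1 : ∀ a b : A, τ.toFun 1 (a * b) = τ.toFun 1 a * τ.toFun 1 b) :
    ∃ φ : A ≃ₗ[k] A,
      (∀ m : ℕ, ∀ a ∈ 𝒜 m, φ a ∈ 𝒜 m) ∧
      (∀ m : ℕ, ∀ a ∈ 𝒜 m, φ.symm a ∈ 𝒜 m) ∧
      φ ((τ.toFun 0).symm 1) = 1 ∧
      ∀ m n : ℕ, ∀ a ∈ 𝒜 m, ∀ b ∈ 𝒜 n,
        φ (a * τ.toFun m b) = φ a * (τ.toFun 1 ^ m) (φ b) := by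
  have h11 : τ.toFun 1 1 = 1 := by
    have h := hτ1 1 ((τ.toFun 1).symm 1)
    rw [one_mul, LinearEquiv.apply_symm_apply, mul_one] at h
    exact h.symm
  have h0s : ∀ b, (τ.toFun 0).symm b = b := by
    intro b
    have h := τ.twist 1 0 1 b SetLike.GradedOne.one_mem
    rw [one_mul, h11, one_mul] at h
    exact ((τ.toFun 1).injective h).symm
  have h0 : ∀ b, τ.toFun 0 b = b := by
    intro b
    rw [← h0s (τ.toFun 0 b), LinearEquiv.symm_apply_apply]
  have hpow : ∀ n, (𝒜 1) ^ n ≤ 𝒜 n := by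
    intro n
    induction n with
    | zero => rw [pow_zero, hconn]
    | succ n ih =>
      rw [pow_succ, Submodule.mul_le]
      intro x hx y hy
      exact SetLike.GradedMul.mul_mem (ih hx) hy
  have hsup : ∀ t : TensorAlgebra k (𝒜 1), ∀ m,
      (DirectSum.decompose 𝒜 (TensorAlgebra.lift k ((𝒜 1).subtype) t) m : A) ∈ (𝒜 1) ^ m := by
    intro t
    induction t using TensorAlgebra.induction with
    | algebraMap r =>
      intro m
      rw [AlgHom.commutes]
      have hr : algebraMap k A r ∈ 𝒜 0 := SetLike.algebraMap_mem_graded 𝒜 r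
      rcases eq_or_ne m 0 with rfl | hm
      · rw [pow_zero, ← hconn]
        exact SetLike.coe_mem _
      · rw [DirectSum.decompose_of_mem_ne 𝒜 hr hm.symm]
        exact zero_mem _
    | ι x =>
      intro m
      rw [TensorAlgebra.lift_ι_apply, Submodule.subtype_apply]
      rcases eq_or_ne m 1 with rfl | hm
      · rw [pow_one]
        exact SetLike.coe_mem _
      · rw [DirectSum.decompose_of_mem_ne 𝒜 x.2 hm.symm]
        exact zero_mem _
    | mul a b ha hb =>
      intro m
      rw [map_mul, DirectSum.decompose_mul, DirectSum.coe_mul_apply_eq_sum_antidiagonal]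
      refine Submodule.sum_mem _ fun ij hij => ?_
      rw [← Finset.HasAntidiagonal.mem_antidiagonal.1 hij, pow_add]
      exact Submodule.mul_mem_mul (ha _) (hb _)
    | add a b ha hb =>
      intro m
      rw [map_add, DirectSum.decompose_add, DirectSum.add_apply, Submodule.coe_add]
      exact add_mem (ha m) (hb m)
  have hle : ∀ m, 𝒜 m ≤ (𝒜 1) ^ m := by
    intro m a ha
    obtain ⟨t, rfl⟩ := hgen a
    have h := hsup t m
    rwa [DirectSum.decompose_of_mem_same 𝒜 ha] at h
  have key : ∀ m, ∀ a ∈ 𝒜 m, ∀ b, a * τ.toFun m b = a * (τ.toFun 1 ^ m) b := by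
    intro m
    induction m with
    | zero => intro a _ b; rw [h0, pow_zero]; rfl
    | succ m ih =>
      intro a ha b
      have ha' := hle _ ha
      rw [pow_succ'] at ha'
      induction ha' using Submodule.mul_induction_on' with
      | mem_mul_mem x hx y hy =>
        obtain ⟨z, rfl⟩ := (τ.toFun 1).surjective y
        have hz : z ∈ 𝒜 m := by
          have := τ.symm_map_mem 1 m _ (hpow m hy)
          rwa [LinearEquiv.symm_apply_apply] at this
        have h1 := τ.twist 1 m z (τ.toFun m b) hz
        rw [LinearEquiv.symm_apply_apply, ih z hz, hτ1, add_comm] at h1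
        rw [mul_assoc, ← h1, mul_assoc, pow_succ']
        rfl
      | add x hx y hy h1 h2 =>
        rw [← pow_succ'] at hx hy
        rw [add_mul, add_mul, h1 (hpow _ hx), h2 (hpow _ hy)]
  refine ⟨LinearEquiv.refl k A, fun _ _ h => h, fun _ _ h => h, h0s 1, ?_⟩
  intro m n a ha b _
  exact key m a ha b
end

section
/- Let k be a field and let A be a connected ℕ-graded k-algebra generated in degree 1. Let f be a degree-0 k-linear automorphism of A. Then the family {f^m : m ∈ ℕ} is a twisting system on A if and only if f is an algebra automorphism of A. -/
/-- Let `k` be a field and `A` a connected ℕ-graded `k`-algebra generated in degree 1,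
with grading `𝒜`.  Let `f` be a degree-0 `k`-linear automorphism of `A`.  Then the
family `{f^m : m ∈ ℕ}` is a twisting system on `A` (i.e. it satisfies the defining
relation `τ_m(a·b) = τ_m(a)·τ_{m+n}(τ_n⁻¹(b))` for all `m, n`, all `a ∈ 𝒜 n` and all
`b`) if and only if `f` is an algebra automorphism of `A`. -/
theorem pow_family_is_twisting_system_iff_algebra_automorphism
    (k A : Type*) [Field k] [Ring A] [Algebra k A]
    (𝒜 : ℕ → Submodule k A) [GradedAlgebra 𝒜]
    (hconn : 𝒜 0 = 1)
    (hgen : Algebra.adjoin k (𝒜 1 : Set A) = ⊤)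
    (f : A ≃ₗ[k] A)
    (hdeg : ∀ m : ℕ, ∀ a ∈ 𝒜 m, f a ∈ 𝒜 m ∧ f.symm a ∈ 𝒜 m) :
    (∀ m n : ℕ, ∀ a b : A, a ∈ 𝒜 n →
        (f ^ m) (a * b) = (f ^ m) a * (f ^ (m + n)) ((f ^ n)⁻¹ b)) ↔
      (∀ a b : A, f (a * b) = f a * f b) := by
  have key : ∀ (m n : ℕ) (b : A), (f ^ (m + n)) ((f ^ n)⁻¹ b) = (f ^ m) b := by
    intro m n b
    rw [← LinearEquiv.mul_apply, pow_add, mul_assoc, mul_inv_cancel, mul_one]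
  constructor
  · intro h a b
    induction a using DirectSum.Decomposition.inductionOn 𝒜 with
    | zero => simp
    | @homogeneous n a =>
      have h1 := h 1 n a b a.2
      rw [key] at h1
      simpa using h1
    | add x y hx hy => rw [add_mul, map_add, map_add, hx, hy, add_mul]
  · intro h m n a b _
    rw [key]
    clear key
    induction m with
    | zero => simp
    | succ m ih => simp only [pow_succ', LinearEquiv.mul_apply, ih, h]
end

section
/- Let k be an algebraically closed field of characteristic 0. Let T be the 4×4 matrix over k with rows (1,0,0,0), (0,1,1,0), (0,0,0,0), (0,0,0,1), and let v = (0,1,−1,0)ᵀ ∈ k⁴. For invertible 2×2 matrices A and B over k, set S = A ⊗ (B·A^{−1}), the Kronecker product of A with B·A^{−1}. Then T·S·v = 0 if and only if there exists μ ∈ k^× with B = μ·A². -/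
open Kronecker

/-- The 4×4 matrix with rows (1,0,0,0), (0,1,1,0), (0,0,0,0), (0,0,0,1),
indexed by `Fin 2 × Fin 2` in the order ((0,0),(0,1),(1,0),(1,1)) corresponding
to the monomial basis (x⊗x, x⊗y, y⊗x, y⊗y). -/
def multMatrix (k : Type*) [Field k] : Matrix (Fin 2 × Fin 2) (Fin 2 × Fin 2) k :=
  fun p q =>
    if p = ((0 : Fin 2), (0 : Fin 2)) ∧ q = ((0 : Fin 2), (0 : Fin 2)) then 1
    else if p = ((0 : Fin 2), (1 : Fin 2)) ∧
        (q = ((0 : Fin 2), (1 : Fin 2)) ∨ q = ((1 : Fin 2), (0 : Fin 2))) then 1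
    else if p = ((1 : Fin 2), (1 : Fin 2)) ∧ q = ((1 : Fin 2), (1 : Fin 2)) then 1
    else 0

/-- The vector v = (0,1,−1,0)ᵀ, corresponding to x⊗y − y⊗x. -/
def commRelVec (k : Type*) [Field k] : Fin 2 × Fin 2 → k :=
  fun q =>
    if q = ((0 : Fin 2), (1 : Fin 2)) then 1
    else if q = ((1 : Fin 2), (0 : Fin 2)) then -1
    else 0

theorem twist_aux (k : Type*) [Field k] (A C : Matrix (Fin 2) (Fin 2) k) :
    (multMatrix k * (A ⊗ₖ C)).mulVec (commRelVec k) = 0 ↔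
      (A 0 0 * C 0 1 = A 0 1 * C 0 0 ∧ A 1 0 * C 1 1 = A 1 1 * C 1 0 ∧
        A 0 0 * C 1 1 + A 1 0 * C 0 1 = A 0 1 * C 1 0 + A 1 1 * C 0 0) := by
  rw [funext_iff]
  simp [Prod.forall, Fin.forall_fin_two, Matrix.mulVec, dotProduct, Matrix.mul_apply,
    Fintype.sum_prod_type, Fin.sum_univ_two, multMatrix, commRelVec]
  constructor
  · rintro ⟨⟨h1, h2⟩, h3⟩
    refine ⟨?_, ?_, ?_⟩ <;> grind
  · rintro ⟨h1, h2, h3⟩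
    refine ⟨⟨?_, ?_⟩, ?_⟩ <;> grind

/-- For invertible 2×2 matrices `A`, `B` over an algebraically closed field `k` of
characteristic zero, setting `S = A ⊗ (B·A⁻¹)` (Kronecker product), one has
`T·S·v = 0` if and only if `B = μ·A²` for some `μ ∈ kˣ`. -/
theorem twisting_condition_iff_B_eq_smul_A_sq
    (k : Type*) [Field k] [IsAlgClosed k] [CharZero k]
    (A B : Matrix (Fin 2) (Fin 2) k) (hA : IsUnit A.det) (hB : IsUnit B.det) :
    (multMatrix k * (A ⊗ₖ (B * A⁻¹))).mulVec (commRelVec k) = 0 ↔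
      ∃ μ : kˣ, B = (μ : k) • (A * A) := by
  rw [twist_aux]
  have hd : A.det ≠ 0 := hA.ne_zero
  constructor
  · intro h
    have hBC : B = (B * A⁻¹) * A := by
      rw [Matrix.mul_assoc, Matrix.nonsing_inv_mul A hA, Matrix.mul_one]
    generalize B * A⁻¹ = C at h hBC
    obtain ⟨h1, h2, h3⟩ := h
    have hC : C = ((C 0 0 * A 1 1 - C 0 1 * A 1 0) / A.det) • A := by
      ext i j
      rw [Matrix.smul_apply, smul_eq_mul, div_mul_eq_mul_div, eq_div_iff hd, Matrix.det_fin_two]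
      fin_cases i <;> fin_cases j <;> simp only [Fin.zero_eta, Fin.mk_one]
      · linear_combination A 1 0 * h1
      · linear_combination A 1 1 * h1
      · linear_combination (-A 0 0) * h2 + A 1 0 * h3
      · linear_combination (-A 0 1) * h2 + A 1 1 * h3
    generalize (C 0 0 * A 1 1 - C 0 1 * A 1 0) / A.det = s at hC
    have hs : s ≠ 0 := by
      rintro rfl
      rw [hBC, hC] at hB
      simp at hB
    refine ⟨Units.mk0 s hs, ?_⟩
    rw [hBC, hC, Units.val_mk0, Matrix.smul_mul]
  · rintro ⟨μ, rfl⟩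
    rw [Matrix.smul_mul, Matrix.mul_assoc, Matrix.mul_nonsing_inv A hA, Matrix.mul_one]
    simp only [Matrix.smul_apply, smul_eq_mul]
    refine ⟨?_, ?_, ?_⟩ <;> ring
end

section
/- Let k be an algebraically closed field of characteristic 0 and let α, β, γ ∈ k^×. Let E ⊂ ℙ²(k) be the union of the three coordinate lines ℓ₁ = {(a:b:c) : a = 0}, ℓ₂ = {(a:b:c) : b = 0}, ℓ₃ = {(a:b:c) : c = 0}, and let μ(α,β,γ) : E → E be the map defined by μ|_{ℓ₁}(0:b:c) = (0:αb:c), μ|_{ℓ₂}(a:0:c) = (a:0:βc), μ|_{ℓ₃}(a:b:0) = (γa:b:0). Then there exists a matrix M ∈ GL₃(k) whose induced automorphism of ℙ²(k) agrees with μ(α,β,γ) at every point of E if and only if αβγ = 1. -/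
open scoped Classical

/-- The union of the three coordinate lines in ℙ², described at the level of
homogeneous coordinate vectors: some coordinate vanishes. -/
def memTriangle {k : Type*} [Field k] (v : Fin 3 → k) : Prop :=
  v 0 = 0 ∨ v 1 = 0 ∨ v 2 = 0

/-- The map μ(α,β,γ) on the union of the three coordinate lines, at the level of
homogeneous coordinate vectors: on ℓ₁ = {a = 0} it sends (0:b:c) to (0:αb:c), on
ℓ₂ = {b = 0} it sends (a:0:c) to (a:0:βc), and on ℓ₃ = {c = 0} it sends (a:b:0)
to (γa:b:0). -/
noncomputable def muVec {k : Type*} [Field k] (α β γ : k) (v : Fin 3 → k) : Fin 3 → k :=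
  if v 0 = 0 then ![0, α * v 1, v 2]
  else if v 1 = 0 then ![v 0, 0, β * v 2]
  else ![γ * v 0, v 1, 0]

/-- There is a matrix `M ∈ GL₃(k)` whose induced automorphism of ℙ²(k) agrees with
μ(α,β,γ) at every point of the triangle `E` of coordinate lines (i.e. for every nonzero
homogeneous coordinate vector of a point of `E`, `M` maps it to a nonzero scalar multiple
of its image under μ(α,β,γ)) if and only if `αβγ = 1`. -/
theorem mu_extends_to_P2_iff_product_eq_one
    (k : Type*) [Field k] [IsAlgClosed k] [CharZero k]
    (α β γ : k) (hα : α ≠ 0) (hβ : β ≠ 0) (hγ : γ ≠ 0) :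
    (∃ M : GL (Fin 3) k, ∀ v : Fin 3 → k, v ≠ 0 → memTriangle v →
      ∃ c : k, c ≠ 0 ∧ (M : Matrix (Fin 3) (Fin 3) k).mulVec v = c • muVec α β γ v) ↔
    α * β * γ = 1 := by
  constructor
  · rintro ⟨M, hM⟩
    generalize (M : Matrix (Fin 3) (Fin 3) k) = A at hM
    have key : ∀ a b c : k, (a ≠ 0 ∨ b ≠ 0 ∨ c ≠ 0) → (a = 0 ∨ b = 0 ∨ c = 0) →
        ∃ d : k, d ≠ 0 ∧ A.mulVec ![a, b, c] = d • muVec α β γ ![a, b, c] := by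
      intro a b c h1 h2
      apply hM
      · intro h
        have e0 := congrFun h 0
        have e1 := congrFun h 1
        have e2 := congrFun h 2
        simp at e0 e1 e2
        tauto
      · simpa [memTriangle] using h2
    obtain ⟨c0, h0, e0⟩ := key 1 0 0 (by simp) (by simp)
    obtain ⟨c1, h1, e1⟩ := key 0 1 0 (by simp) (by simp)
    obtain ⟨c2, h2, e2⟩ := key 0 0 1 (by simp) (by simp)
    obtain ⟨d0, g0, f0⟩ := key 0 1 1 (by simp) (by simp)
    obtain ⟨d1, g1, f1⟩ := key 1 0 1 (by simp) (by simp)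
    obtain ⟨d2, g2, f2⟩ := key 1 1 0 (by simp) (by simp)
    simp [muVec, funext_iff, Fin.forall_fin_succ, Matrix.mulVec, dotProduct,
      Fin.sum_univ_succ] at e0 e1 e2 f0 f1 f2
    obtain ⟨a00, a10, a20⟩ := e0
    obtain ⟨a01, a11, a21⟩ := e1
    obtain ⟨a02, a12, a22⟩ := e2
    simp only [a00, a10, a20, a01, a11, a21, a02, a12, a22, add_zero, zero_add, true_and,
      and_true] at f0 f1 f2
    obtain ⟨x0, y0⟩ := f0
    obtain ⟨x1, y1⟩ := f1
    obtain ⟨x2, y2⟩ := f2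
    have : c2 * (α * β * γ - 1) = 0 := by
      subst y0 x1 x2
      grind
    rcases mul_eq_zero.mp this with h | h
    · exact absurd h h2
    · exact sub_eq_zero.mp h
  · intro h
    refine ⟨Matrix.GeneralLinearGroup.mkOfDetNeZero (Matrix.diagonal ![1, α * β, β]) ?_, ?_⟩
    · simp [Matrix.det_diagonal, Fin.prod_univ_succ, hα, hβ]
    · intro v _ hm
      change ∃ c : k, c ≠ 0 ∧ (Matrix.diagonal ![1, α * β, β]).mulVec v = c • muVec α β γ v
      unfold muVec
      split_ifs with h0 h1
      · refine ⟨β, hβ, ?_⟩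
        ext i
        fin_cases i <;> simp [Matrix.mulVec_diagonal, h0] <;> ring
      · refine ⟨1, one_ne_zero, ?_⟩
        ext i
        fin_cases i <;> simp [Matrix.mulVec_diagonal, h1]
      · have h2 : v 2 = 0 := by
          rcases hm with hm | hm | hm
          · exact absurd hm h0
          · exact absurd hm h1
          · exact hm
        refine ⟨α * β, mul_ne_zero hα hβ, ?_⟩
        ext i
        fin_cases i <;> simp [Matrix.mulVec_diagonal, h2]
        rw [← mul_assoc, h, one_mul]
end

section
/- Let k be an algebraically closed field of characteristic 0. Let Q = (α,β,γ) and Q' = (α',β',γ') be triples of elements of k^× with αβγ ∉ {0,1} and α'β'γ' ∉ {0,1}. Then the graded algebras O_Q(ℙ²) and O_{Q'}(ℙ²) are twist-equivalent if and only if α'β'γ' = αβγ or α'β'γ' = (αβγ)^{−1}. -/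
/-- Graded algebras `A` (graded by `𝒜`) and `B` (graded by `ℬ`) are twist-equivalent if
there is a twisting system `τ` on `A` such that `B` is isomorphic to the twisted algebra
`A^τ` as a graded `k`-algebra, i.e. there is a degree-preserving `k`-linear equivalence
`φ : B ≃ A` with `φ(1) = τ₀⁻¹(1)` (the identity of `A^τ`) and
`φ(a·b) = φ(a) ⋆ φ(b) = φ(a)·τ_m(φ(b))` for homogeneous `a` of degree `m`. -/
def TwistEquivalent (k : Type*) {A B : Type*} [CommSemiring k] [Semiring A] [Algebra k A]
    [Semiring B] [Algebra k B] (𝒜 : ℕ → Submodule k A) (ℬ : ℕ → Submodule k B) : Prop :=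
  ∃ (τ : TwistingSystem k 𝒜) (φ : B ≃ₗ[k] A),
    (∀ m : ℕ, ∀ b ∈ ℬ m, φ b ∈ 𝒜 m) ∧
    (∀ m : ℕ, ∀ a ∈ 𝒜 m, φ.symm a ∈ ℬ m) ∧
    φ 1 = (τ.toFun 0).symm 1 ∧
    (∀ m n : ℕ, ∀ a b : B, a ∈ ℬ m → b ∈ ℬ n →
      φ (a * b) = φ a * τ.toFun m (φ b))

/-- The defining relations of `O_{(α,β,γ)}(ℙ²)`: `zy = αyz`, `xz = βzx`, `yx = γxy`,
where `x, y, z` are the generators `ι 0, ι 1, ι 2` of the free algebra on three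
variables. -/
inductive QuantumP2Rel (K : Type*) [Field K] (α β γ : K) :
    FreeAlgebra K (Fin 3) → FreeAlgebra K (Fin 3) → Prop
  | zy : QuantumP2Rel K α β γ (FreeAlgebra.ι K (2 : Fin 3) * FreeAlgebra.ι K (1 : Fin 3))
      (α • (FreeAlgebra.ι K (1 : Fin 3) * FreeAlgebra.ι K (2 : Fin 3)))
  | xz : QuantumP2Rel K α β γ (FreeAlgebra.ι K (0 : Fin 3) * FreeAlgebra.ι K (2 : Fin 3))
      (β • (FreeAlgebra.ι K (2 : Fin 3) * FreeAlgebra.ι K (0 : Fin 3)))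
  | yx : QuantumP2Rel K α β γ (FreeAlgebra.ι K (1 : Fin 3) * FreeAlgebra.ι K (0 : Fin 3))
      (γ • (FreeAlgebra.ι K (0 : Fin 3) * FreeAlgebra.ι K (1 : Fin 3)))

/-- The multiparameter quantum projective plane coordinate ring
`O_{(α,β,γ)}(ℙ²) = K⟨x,y,z⟩/⟨zy − αyz, xz − βzx, yx − γxy⟩`. -/
def QuantumP2 (K : Type*) [Field K] (α β γ : K) : Type _ :=
  RingQuot (QuantumP2Rel K α β γ)

noncomputable instance (K : Type*) [Field K] (α β γ : K) : Ring (QuantumP2 K α β γ) :=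
  inferInstanceAs (Ring (RingQuot (QuantumP2Rel K α β γ)))

noncomputable instance (K : Type*) [Field K] (α β γ : K) : Algebra K (QuantumP2 K α β γ) :=
  inferInstanceAs (Algebra K (RingQuot (QuantumP2Rel K α β γ)))

/-- The images `x, y, z` of the three generators in `O_{(α,β,γ)}(ℙ²)`. -/
noncomputable def QuantumP2.gen (K : Type*) [Field K] (α β γ : K) (i : Fin 3) :
    QuantumP2 K α β γ :=
  RingQuot.mkAlgHom K (QuantumP2Rel K α β γ) (FreeAlgebra.ι K i)

/-- The standard grading of `O_{(α,β,γ)}(ℙ²)` (`deg x = deg y = deg z = 1`): the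
degree-`m` component is the `m`-th power of the span of the generators. -/
noncomputable def QuantumP2.grading (K : Type*) [Field K] (α β γ : K) (m : ℕ) :
    Submodule K (QuantumP2 K α β γ) :=
  (Submodule.span K (Set.range (QuantumP2.gen K α β γ))) ^ m

namespace QuantumP2

section basics
variable {K : Type*} [Field K] {α β γ : K}

lemma gen_zy : gen K α β γ 2 * gen K α β γ 1 = α • (gen K α β γ 1 * gen K α β γ 2) := by
  have := RingQuot.mkAlgHom_rel K (QuantumP2Rel.zy (K := K) (α := α) (β := β) (γ := γ))
  rw [map_mul, map_smul, map_mul] at this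
  exact this

lemma gen_xz : gen K α β γ 0 * gen K α β γ 2 = β • (gen K α β γ 2 * gen K α β γ 0) := by
  have := RingQuot.mkAlgHom_rel K (QuantumP2Rel.xz (K := K) (α := α) (β := β) (γ := γ))
  rw [map_mul, map_smul, map_mul] at this
  exact this

lemma gen_yx : gen K α β γ 1 * gen K α β γ 0 = γ • (gen K α β γ 0 * gen K α β γ 1) := by
  have := RingQuot.mkAlgHom_rel K (QuantumP2Rel.yx (K := K) (α := α) (β := β) (γ := γ))
  rw [map_mul, map_smul, map_mul] at this
  exact this

/-- The three relations for a triple of elements of an algebra. -/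
def Sat (K : Type*) [Field K] (α β γ : K) {R : Type*} [Ring R] [Algebra K R]
    (f : Fin 3 → R) : Prop :=
  f 2 * f 1 = α • (f 1 * f 2) ∧ f 0 * f 2 = β • (f 2 * f 0) ∧ f 1 * f 0 = γ • (f 0 * f 1)

lemma exists_lift {R : Type*} [Ring R] [Algebra K R] (f : Fin 3 → R) (hf : Sat K α β γ f) :
    ∃ g : QuantumP2 K α β γ →ₐ[K] R, ∀ i, g (gen K α β γ i) = f i := by
  let g : RingQuot (QuantumP2Rel K α β γ) →ₐ[K] R :=
    RingQuot.liftAlgHom K ⟨FreeAlgebra.lift K f, by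
    intro a b hab
    cases hab
    · simpa using hf.1
    · simpa using hf.2.1
    · simpa using hf.2.2⟩
  refine ⟨g, fun i => ?_⟩
  have : g (RingQuot.mkAlgHom K (QuantumP2Rel K α β γ) (FreeAlgebra.ι K i)) = f i := by
    simp [g]
  exact this

lemma ind {P : QuantumP2 K α β γ → Prop}
    (h1 : ∀ r : K, P (algebraMap K _ r)) (h2 : ∀ i, P (gen K α β γ i))
    (h3 : ∀ a b, P a → P b → P (a * b)) (h4 : ∀ a b, P a → P b → P (a + b))
    (a : QuantumP2 K α β γ) : P a := by
  obtain ⟨w, rfl⟩ := RingQuot.mkAlgHom_surjective K (QuantumP2Rel K α β γ) a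
  induction w using FreeAlgebra.induction with
  | grade0 r =>
    have h := h1 r
    rw [AlgHom.commutes]
    exact h
  | grade1 x => exact h2 x
  | mul a b ha hb =>
    rw [map_mul]
    exact h3 _ _ ha hb
  | add a b ha hb =>
    rw [map_add]
    exact h4 _ _ ha hb

lemma gen_mem (i : Fin 3) : gen K α β γ i ∈ grading K α β γ 1 := by
  rw [grading, pow_one]
  exact Submodule.subset_span ⟨i, rfl⟩

lemma mul_mem_grading {m n : ℕ} {a b : QuantumP2 K α β γ} (ha : a ∈ grading K α β γ m)
    (hb : b ∈ grading K α β γ n) : a * b ∈ grading K α β γ (m + n) := by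
  rw [grading, pow_add]
  exact Submodule.mul_mem_mul ha hb

/-- Induction on homogeneous elements. -/
lemma grading_ind {P : ℕ → QuantumP2 K α β γ → Prop}
    (h1 : ∀ r : K, P 0 (algebraMap K _ r))
    (hadd : ∀ n a b, P n a → P n b → P n (a + b))
    (hsmul : ∀ n (r : K) a, P n a → P n (r • a))
    (hgen : ∀ n i a, a ∈ grading K α β γ n → P n a → P (n + 1) (gen K α β γ i * a))
    (n : ℕ) (a : QuantumP2 K α β γ) (ha : a ∈ grading K α β γ n) : P n a := by
  induction n generalizing a with
  | zero =>
    rw [grading, pow_zero, Submodule.mem_one] at ha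
    obtain ⟨r, rfl⟩ := ha
    exact h1 r
  | succ n ih =>
    rw [grading, pow_succ'] at ha
    refine Submodule.mul_induction_on ha ?_ (fun a b => hadd _ a b)
    intro u hu v hv
    have hv' := ih v hv
    induction hu using Submodule.span_induction with
    | mem x hx =>
      obtain ⟨i, rfl⟩ := hx
      exact hgen n i v hv hv'
    | zero =>
      have := hsmul (n + 1) 0 _ (hgen n 0 v hv hv')
      simpa using this
    | add x y _ _ hx hy => rw [add_mul]; exact hadd _ _ _ hx hy
    | smul r x _ hx => rw [smul_mul_assoc]; exact hsmul _ _ _ hx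

lemma mem_grading_one {a : QuantumP2 K α β γ} (ha : a ∈ grading K α β γ 1) :
    ∃ c : Fin 3 → K, a = ∑ i, c i • gen K α β γ i := by
  rw [grading, pow_one] at ha
  obtain ⟨c, hc⟩ := (Submodule.mem_span_range_iff_exists_fun K).1 ha
  exact ⟨c, hc.symm⟩

/-- Diagonal endomorphism. -/
lemma exists_diag (t : Fin 3 → K) : ∃ g : QuantumP2 K α β γ →ₐ[K] QuantumP2 K α β γ,
    ∀ i, g (gen K α β γ i) = t i • gen K α β γ i := by
  apply exists_lift (fun i => t i • gen K α β γ i)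
  refine ⟨?_, ?_, ?_⟩ <;> simp only [smul_mul_smul_comm, gen_zy, gen_xz, gen_yx, smul_smul] <;>
    congr 1 <;> ring

lemma exists_diagEquiv (t : Fin 3 → K) (ht : ∀ i, t i ≠ 0) :
    ∃ g : QuantumP2 K α β γ ≃ₐ[K] QuantumP2 K α β γ,
    (∀ i, g (gen K α β γ i) = t i • gen K α β γ i) ∧
    (∀ i, g.symm (gen K α β γ i) = (t i)⁻¹ • gen K α β γ i) := by
  obtain ⟨g, hg⟩ := exists_diag (α := α) (β := β) (γ := γ) t
  obtain ⟨h, hh⟩ := exists_diag (α := α) (β := β) (γ := γ) (fun i => (t i)⁻¹)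
  have e1 : ∀ a, g (h a) = a := by
    intro a
    induction a using ind with
    | h1 r => simp
    | h2 i => simp [hg, hh, smul_smul, ht]
    | h3 a b ha hb => simp [ha, hb]
    | h4 a b ha hb => simp [ha, hb]
  have e2 : ∀ a, h (g a) = a := by
    intro a
    induction a using ind with
    | h1 r => simp
    | h2 i => simp [hg, hh, smul_smul, ht]
    | h3 a b ha hb => simp [ha, hb]
    | h4 a b ha hb => simp [ha, hb]
  exact ⟨AlgEquiv.ofAlgHom g h (AlgHom.ext e1) (AlgHom.ext e2), hg, hh⟩

lemma diag_mem (g : QuantumP2 K α β γ →ₐ[K] QuantumP2 K α β γ) (t : Fin 3 → K)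
    (hg : ∀ i, g (gen K α β γ i) = t i • gen K α β γ i) (n : ℕ) (a : QuantumP2 K α β γ)
    (ha : a ∈ grading K α β γ n) : g a ∈ grading K α β γ n := by
  refine grading_ind (P := fun n a => g a ∈ grading K α β γ n) ?_ ?_ ?_ ?_ n a ha
  · intro r
    rw [AlgHom.commutes, grading, pow_zero]
    exact Submodule.algebraMap_mem r
  · intro n a b ha hb
    rw [map_add]; exact add_mem ha hb
  · intro n r a ha
    rw [map_smul]; exact Submodule.smul_mem _ _ ha
  · intro n i a _ ha
    rw [map_mul, hg, smul_mul_assoc, add_comm]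
    exact Submodule.smul_mem _ _ (mul_mem_grading (gen_mem i) ha)

end basics

section backward
variable {K : Type*} [Field K] {α β γ α' β' γ' : K}

/-- Half of the twist isomorphism. -/
lemma exists_half (s : Fin 3 → Fin 3) (t : Fin 3 → K)
    (σ : QuantumP2 K α β γ ≃ₐ[K] QuantumP2 K α β γ)
    (σ' : QuantumP2 K α' β' γ' ≃ₐ[K] QuantumP2 K α' β' γ')
    (hσ : ∀ i, σ (gen K α β γ i) = t i • gen K α β γ i)
    (hσ' : ∀ i, σ' (gen K α' β' γ' i) = t (s i) • gen K α' β' γ' i)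
    (H1 : t (s 1) • (gen K α β γ (s 2) * gen K α β γ (s 1)) =
      (α' * t (s 2)) • (gen K α β γ (s 1) * gen K α β γ (s 2)))
    (H2 : t (s 2) • (gen K α β γ (s 0) * gen K α β γ (s 2)) =
      (β' * t (s 0)) • (gen K α β γ (s 2) * gen K α β γ (s 0)))
    (H3 : t (s 0) • (gen K α β γ (s 1) * gen K α β γ (s 0)) =
      (γ' * t (s 1)) • (gen K α β γ (s 0) * gen K α β γ (s 1))) :
    ∃ φ : QuantumP2 K α' β' γ' →ₗ[K] QuantumP2 K α β γ,
      φ 1 = 1 ∧ (∀ i b, φ (gen K α' β' γ' i * b) = gen K α β γ (s i) * σ (φ b)) ∧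
      (∀ b, φ (σ' b) = σ (φ b)) := by
  obtain ⟨ρ, hρ⟩ := exists_lift (α := α') (β := β') (γ := γ')
    (R := Module.End K (QuantumP2 K α β γ))
    (fun i => LinearMap.mulLeft K (gen K α β γ (s i)) * σ.toLinearMap) (by
      refine ⟨?_, ?_, ?_⟩
      · ext a
        simp only [Module.End.mul_apply, LinearMap.mulLeft_apply, AlgEquiv.toLinearMap_apply,
          map_mul, hσ, LinearMap.smul_apply]
        simp only [smul_mul_assoc, mul_smul_comm, ← mul_assoc, smul_smul]
        rw [← smul_mul_assoc, H1, smul_mul_assoc]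
      · ext a
        simp only [Module.End.mul_apply, LinearMap.mulLeft_apply, AlgEquiv.toLinearMap_apply,
          map_mul, hσ, LinearMap.smul_apply]
        simp only [smul_mul_assoc, mul_smul_comm, ← mul_assoc, smul_smul]
        rw [← smul_mul_assoc, H2, smul_mul_assoc]
      · ext a
        simp only [Module.End.mul_apply, LinearMap.mulLeft_apply, AlgEquiv.toLinearMap_apply,
          map_mul, hσ, LinearMap.smul_apply]
        simp only [smul_mul_assoc, mul_smul_comm, ← mul_assoc, smul_smul]
        rw [← smul_mul_assoc, H3, smul_mul_assoc])
  refine ⟨(LinearMap.applyₗ (1 : QuantumP2 K α β γ)).comp ρ.toLinearMap, ?_, ?_, ?_⟩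
  · simp
  · intro i b
    simp [hρ]
  · intro b
    have key : ∀ b a, ρ (σ' b) (σ a) = σ (ρ b a) := by
      intro b
      induction b using ind with
      | h1 r => intro a; simp [Module.algebraMap_end_apply]
      | h2 i => intro a; simp [hσ', hρ, hσ]
      | h3 a b ha hb => intro c; simp [ha, hb]
      | h4 a b ha hb => intro c; simp [ha, hb]
    have := key b 1
    simpa using this

lemma gens_id (Φ : QuantumP2 K α β γ →ₗ[K] QuantumP2 K α β γ) (h1 : Φ 1 = 1)
    (h2 : ∀ i a, Φ (gen K α β γ i * a) = gen K α β γ i * Φ a) (a : QuantumP2 K α β γ) :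
    Φ a = a := by
  have key : ∀ a b, Φ (a * b) = a * Φ b := by
    intro a
    induction a using ind with
    | h1 r => intro b; simp [← Algebra.smul_def]
    | h2 i => exact h2 i
    | h3 a b ha hb => intro c; rw [mul_assoc, ha, hb, mul_assoc]
    | h4 a b ha hb => intro c; rw [add_mul, map_add, ha, hb, add_mul]
  simpa [h1] using key a 1

lemma twistEquivalent_of (s : Fin 3 → Fin 3) (hs : ∀ i, s (s i) = i) (t : Fin 3 → K)
    (ht : ∀ i, t i ≠ 0)
    (H1 : t (s 1) • (gen K α β γ (s 2) * gen K α β γ (s 1)) =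
      (α' * t (s 2)) • (gen K α β γ (s 1) * gen K α β γ (s 2)))
    (H2 : t (s 2) • (gen K α β γ (s 0) * gen K α β γ (s 2)) =
      (β' * t (s 0)) • (gen K α β γ (s 2) * gen K α β γ (s 0)))
    (H3 : t (s 0) • (gen K α β γ (s 1) * gen K α β γ (s 0)) =
      (γ' * t (s 1)) • (gen K α β γ (s 0) * gen K α β γ (s 1)))
    (G1 : (t 1)⁻¹ • (gen K α' β' γ' (s 2) * gen K α' β' γ' (s 1)) =
      (α * (t 2)⁻¹) • (gen K α' β' γ' (s 1) * gen K α' β' γ' (s 2)))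
    (G2 : (t 2)⁻¹ • (gen K α' β' γ' (s 0) * gen K α' β' γ' (s 2)) =
      (β * (t 0)⁻¹) • (gen K α' β' γ' (s 2) * gen K α' β' γ' (s 0)))
    (G3 : (t 0)⁻¹ • (gen K α' β' γ' (s 1) * gen K α' β' γ' (s 0)) =
      (γ * (t 1)⁻¹) • (gen K α' β' γ' (s 0) * gen K α' β' γ' (s 1))) :
    TwistEquivalent K (grading K α β γ) (grading K α' β' γ') := by
  obtain ⟨σ, hσ, hσi⟩ := exists_diagEquiv (α := α) (β := β) (γ := γ) t ht
  obtain ⟨σ', hσ', hσi'⟩ := exists_diagEquiv (α := α') (β := β') (γ := γ') (fun i => t (s i))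
    (fun i => ht _)
  obtain ⟨φ, φ1, φg, φσ⟩ := exists_half s t σ σ' hσ hσ' H1 H2 H3
  obtain ⟨ψ, ψ1, ψg, ψσ⟩ := exists_half (α := α') (β := β') (γ := γ') (α' := α) (β' := β)
    (γ' := γ) s (fun i => (t (s i))⁻¹) σ'.symm σ.symm hσi'
    (by intro i; simpa [hs] using hσi i) (by simpa [hs] using G1)
    (by simpa [hs] using G2) (by simpa [hs] using G3)
  have e1 : ∀ a, φ (ψ a) = a := by
    apply gens_id (φ.comp ψ)
    · simp [φ1, ψ1]
    · intro i a
      simp only [LinearMap.comp_apply, ψg, φg, hs, ← φσ, AlgEquiv.apply_symm_apply]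
  have e2 : ∀ a, ψ (φ a) = a := by
    apply gens_id (ψ.comp φ)
    · simp [φ1, ψ1]
    · intro i a
      simp only [LinearMap.comp_apply, ψg, φg, hs, ← ψσ, AlgEquiv.symm_apply_apply]
  have σmem := diag_mem σ.toAlgHom t hσ
  have σmem' := diag_mem σ.symm.toAlgHom _ hσi
  have σ'mem' := diag_mem σ'.symm.toAlgHom _ hσi'
  have pm : ∀ n m : ℕ, ∀ a ∈ grading K α β γ m, (σ ^ n) a ∈ grading K α β γ m := by
    intro n
    induction n with
    | zero => intro m a ha; simpa using ha
    | succ n ih =>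
      intro m a ha
      rw [pow_succ, AlgEquiv.mul_apply]
      exact ih m _ (σmem m a ha)
  have pm' : ∀ n m : ℕ, ∀ a ∈ grading K α β γ m, (σ ^ n).symm a ∈ grading K α β γ m := by
    intro n
    induction n with
    | zero => intro m a ha; exact ha
    | succ n ih =>
      intro m a ha
      have : (σ ^ (n + 1)).symm a = (σ ^ n).symm (σ.symm a) := by
        rw [AlgEquiv.symm_apply_eq, pow_succ', AlgEquiv.mul_apply, AlgEquiv.apply_symm_apply,
          AlgEquiv.apply_symm_apply]
      rw [this]
      exact ih m _ (σmem' m a ha)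
  refine ⟨⟨fun n => (σ ^ n).toLinearEquiv, pm, pm', ?_⟩, LinearEquiv.ofLinearMap φ ψ
    (LinearMap.ext e1) (LinearMap.ext e2), ?_, ?_, ?_, ?_⟩
  · intro m n a b _
    change (σ ^ m) (a * b) = (σ ^ m) a * (σ ^ (m + n)) ((σ ^ n).symm b)
    rw [pow_add, AlgEquiv.mul_apply, AlgEquiv.apply_symm_apply, map_mul]
  · refine grading_ind (P := fun n a => φ a ∈ grading K α β γ n) ?_ ?_ ?_ ?_
    · intro r
      rw [Algebra.algebraMap_eq_smul_one, map_smul, φ1, ← Algebra.algebraMap_eq_smul_one,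
        grading, pow_zero]
      exact Submodule.algebraMap_mem r
    · intro n a b ha hb
      rw [map_add]; exact add_mem ha hb
    · intro n r a ha
      rw [map_smul]; exact Submodule.smul_mem _ _ ha
    · intro n i a _ ha
      rw [φg, add_comm]
      exact mul_mem_grading (gen_mem _) (σmem _ _ ha)
  · refine grading_ind (P := fun n a => ψ a ∈ grading K α' β' γ' n) ?_ ?_ ?_ ?_
    · intro r
      rw [Algebra.algebraMap_eq_smul_one, map_smul, ψ1, ← Algebra.algebraMap_eq_smul_one,
        grading, pow_zero]
      exact Submodule.algebraMap_mem r
    · intro n a b ha hb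
      rw [map_add]; exact add_mem ha hb
    · intro n r a ha
      rw [map_smul]; exact Submodule.smul_mem _ _ ha
    · intro n i a _ ha
      rw [ψg, add_comm]
      exact mul_mem_grading (gen_mem _) (σ'mem' _ _ ha)
  · change φ 1 = (σ ^ 0).symm 1
    rw [φ1, map_one]
  · intro m n a b ha _
    change φ (a * b) = φ a * (σ ^ m) (φ b)
    refine grading_ind (P := fun m a => φ (a * b) = φ a * (σ ^ m) (φ b)) ?_ ?_ ?_ ?_ m a ha
    · intro r
      rw [← Algebra.smul_def, map_smul, Algebra.algebraMap_eq_smul_one, map_smul, φ1]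
      simp
    · intro n a c ha hc
      rw [add_mul, map_add, ha, hc, map_add, add_mul]
    · intro n r a ha
      rw [smul_mul_assoc, map_smul, ha, map_smul, smul_mul_assoc]
    · intro n i a _ ha
      rw [mul_assoc, φg, ha, φg, map_mul, pow_succ', AlgEquiv.mul_apply, mul_assoc]

lemma twistEquivalent_of_eq (hα : α ≠ 0) (hβ : β ≠ 0) (hγ : γ ≠ 0)
    (hα' : α' ≠ 0) (hβ' : β' ≠ 0) (h : α' * β' * γ' = α * β * γ) :
    TwistEquivalent K (grading K α β γ) (grading K α' β' γ') := by
  have hg : γ' = α * β * γ / (α' * β') := by field_simp; linear_combination h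
  apply twistEquivalent_of id (fun _ => rfl) ![β / β', α' / α, 1]
  · intro i; fin_cases i <;> simp [*]
  all_goals
    simp only [id, gen_zy, gen_xz, gen_yx, smul_smul]
    congr 1
    simp
    try rw [hg]
    try field_simp

lemma twistEquivalent_of_inv (hα : α ≠ 0) (hβ : β ≠ 0) (hγ : γ ≠ 0)
    (hα' : α' ≠ 0) (hβ' : β' ≠ 0) (h : α' * β' * γ' = (α * β * γ)⁻¹) :
    TwistEquivalent K (grading K α β γ) (grading K α' β' γ') := by
  have hg : γ' = 1 / (α * β * γ * (α' * β')) := by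
    have : α' * β' * γ' * (α * β * γ) = 1 := by rw [h]; field_simp
    field_simp; linear_combination this
  have h0 : (Equiv.swap (0 : Fin 3) 1) 0 = 1 := by decide
  have h1 : (Equiv.swap (0 : Fin 3) 1) 1 = 0 := by decide
  have h2 : (Equiv.swap (0 : Fin 3) 1) 2 = 2 := by decide
  apply twistEquivalent_of (Equiv.swap (0 : Fin 3) 1) (by decide) ![α' * β, (α * β')⁻¹, 1]
  · intro i; fin_cases i <;> simp [*]
  all_goals
    simp only [h0, h1, h2, gen_zy, gen_xz, gen_yx, smul_smul]
    congr 1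
    simp
    try rw [hg]
    try field_simp

end backward

end QuantumP2

namespace QuantumP2

section forward
variable {K : Type*} [Field K] {α β γ α' β' γ' : K}

lemma exists_model (hβ : β ≠ 0) :
    ∃ L : QuantumP2 K α β γ →ₗ[K] (ℕ × ℕ × ℕ →₀ K),
      L (gen K α β γ 0) = Finsupp.single (1, 0, 0) 1 ∧
      L (gen K α β γ 1) = Finsupp.single (0, 1, 0) 1 ∧
      L (gen K α β γ 2) = Finsupp.single (0, 0, 1) 1 ∧
      L (gen K α β γ 0 * gen K α β γ 0) = Finsupp.single (2, 0, 0) 1 ∧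
      L (gen K α β γ 1 * gen K α β γ 1) = Finsupp.single (0, 2, 0) 1 ∧
      L (gen K α β γ 2 * gen K α β γ 2) = Finsupp.single (0, 0, 2) 1 ∧
      L (gen K α β γ 0 * gen K α β γ 1) = Finsupp.single (1, 1, 0) 1 ∧
      L (gen K α β γ 1 * gen K α β γ 2) = Finsupp.single (0, 1, 1) 1 ∧
      L (gen K α β γ 2 * gen K α β γ 0) = Finsupp.single (1, 0, 1) β⁻¹ := by
  let X : Module.End K (ℕ × ℕ × ℕ →₀ K) :=
    Finsupp.linearCombination K (fun v => Finsupp.single (v.1 + 1, v.2.1, v.2.2) (1 : K))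
  let Y : Module.End K (ℕ × ℕ × ℕ →₀ K) :=
    Finsupp.linearCombination K (fun v => Finsupp.single (v.1, v.2.1 + 1, v.2.2) (γ ^ v.1))
  let Z : Module.End K (ℕ × ℕ × ℕ →₀ K) :=
    Finsupp.linearCombination K
      (fun v => Finsupp.single (v.1, v.2.1, v.2.2 + 1) (β⁻¹ ^ v.1 * α ^ v.2.1))
  obtain ⟨ρ, hρ⟩ := exists_lift (α := α) (β := β) (γ := γ) ![X, Y, Z] (by
    refine ⟨?_, ?_, ?_⟩ <;> refine Finsupp.lhom_ext' fun v => LinearMap.ext_ring ?_ <;>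
      simp [X, Y, Z, pow_succ, -Finsupp.single_mul] <;> congr 1 <;> field_simp)
  refine ⟨(LinearMap.applyₗ (Finsupp.single (0, 0, 0) 1)).comp ρ.toLinearMap, ?_⟩
  simp [hρ, X, Y, Z, -Finsupp.single_mul]

lemma coef_one (hβ : β ≠ 0) (c : Fin 3 → K) (h : ∑ i, c i • gen K α β γ i = 0) : c = 0 := by
  obtain ⟨L, h0, h1, h2, -⟩ := exists_model (α := α) (β := β) (γ := γ) hβ
  have h' := congrArg L h
  simp only [Fin.sum_univ_three, map_add, map_smul, h0, h1, h2, map_zero] at h'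
  have a0 := DFunLike.congr_fun h' (1, 0, 0)
  have a1 := DFunLike.congr_fun h' (0, 1, 0)
  have a2 := DFunLike.congr_fun h' (0, 0, 1)
  simp at a0 a1 a2
  funext i
  fin_cases i <;> assumption

lemma coef_two (hβ : β ≠ 0) (c : Fin 3 → Fin 3 → K)
    (h : ∑ i, ∑ j, c i j • (gen K α β γ i * gen K α β γ j) = 0) :
    (∀ i, c i i = 0) ∧ c 0 1 + γ * c 1 0 = 0 ∧ c 1 2 + α * c 2 1 = 0 ∧
      c 2 0 + β * c 0 2 = 0 := by
  obtain ⟨L, -, -, -, h0, h1, h2, h3, h4, h5⟩ := exists_model (α := α) (β := β) (γ := γ) hβ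
  have h' := congrArg L h
  simp only [Fin.sum_univ_three, map_add, map_smul, gen_zy, gen_xz, gen_yx, h0, h1, h2, h3, h4,
    h5, map_zero] at h'
  have a0 := DFunLike.congr_fun h' (2, 0, 0)
  have a1 := DFunLike.congr_fun h' (0, 2, 0)
  have a2 := DFunLike.congr_fun h' (0, 0, 2)
  have a3 := DFunLike.congr_fun h' (1, 1, 0)
  have a4 := DFunLike.congr_fun h' (0, 1, 1)
  have a5 := DFunLike.congr_fun h' (1, 0, 1)
  simp at a0 a1 a2 a3 a4 a5
  refine ⟨?_, ?_, ?_, ?_⟩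
  · intro i
    fin_cases i <;> assumption
  · linear_combination a3
  · linear_combination a4
  · field_simp at a5
    linear_combination a5

/-- The three bilinear relations. -/
def E (α β γ : K) (a b : Fin 3 → K) : Fin 3 → K :=
  ![a 2 * b 1 - α * (a 1 * b 2), a 0 * b 2 - β * (a 2 * b 0), a 1 * b 0 - γ * (a 0 * b 1)]

lemma E_zero (hα : α ≠ 0) (hβ : β ≠ 0) (hγ : γ ≠ 0) (h1 : α * β * γ ≠ 1) {a b : Fin 3 → K}
    (ha : a ≠ 0) (hb : b ≠ 0) (h : E α β γ a b = 0) :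
    (∀ i, a i = 0 ↔ b i = 0) ∧ ∃ i, a i = 0 := by
  have e0 := congrFun h 0
  have e1 := congrFun h 1
  have e2 := congrFun h 2
  simp [E] at e0 e1 e2
  have ha' : ¬ (a 0 = 0 ∧ a 1 = 0 ∧ a 2 = 0) := by
    rintro ⟨x, y, z⟩; apply ha; funext i; fin_cases i <;> assumption
  have hb' : ¬ (b 0 = 0 ∧ b 1 = 0 ∧ b 2 = 0) := by
    rintro ⟨x, y, z⟩; apply hb; funext i; fin_cases i <;> assumption
  have pat : ∀ i, a i = 0 ↔ b i = 0 := by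
    intro i
    fin_cases i <;> simp <;> constructor <;> intro hz <;> simp [hz, hα, hβ, hγ] at e0 e1 e2 <;>
      tauto
  refine ⟨pat, ?_⟩
  by_contra! hne
  have n0 := hne 0
  have n1 := hne 1
  have n2 := hne 2
  have m0 : b 0 ≠ 0 := fun h => n0 ((pat 0).2 h)
  have m1 : b 1 ≠ 0 := fun h => n1 ((pat 1).2 h)
  have m2 : b 2 ≠ 0 := fun h => n2 ((pat 2).2 h)
  apply h1
  have key : (a 2 * b 1) * (a 0 * b 2) * (a 1 * b 0) =
      (α * (a 1 * b 2)) * (β * (a 2 * b 0)) * (γ * (a 0 * b 1)) := by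
    rw [sub_eq_zero.1 e0, sub_eq_zero.1 e1, sub_eq_zero.1 e2]
  have n : a 0 * a 1 * a 2 * (b 0 * b 1 * b 2) ≠ 0 := by positivity
  apply mul_right_cancel₀ n
  linear_combination -key

lemma common_zero [Infinite K] {a b a' b' : Fin 3 → K} {g : K} (hg : g ≠ 0)
    (hα : α ≠ 0) (hβ : β ≠ 0) (hγ : γ ≠ 0) (h1 : α * β * γ ≠ 1)
    (ha : ∀ t : K, a + t • a' ≠ 0) (hb : ∀ t : K, b + t • b' ≠ 0)
    (e1 : E α β γ a b = 0) (e2 : E α β γ a' b' = 0)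
    (e3 : E α β γ a b' + g • E α β γ a' b = 0) : ∃ i, a i = 0 ∧ a' i = 0 := by
  have key : ∀ t : K, ∃ i, (a + t • a') i = 0 := by
    intro t
    refine (E_zero hα hβ hγ h1 (ha t) (hb (t / g)) ?_).2
    have : E α β γ (a + t • a') (b + (t / g) • b') = E α β γ a b + (t * (t / g)) • E α β γ a' b'
        + (t / g) • (E α β γ a b' + g • E α β γ a' b) := by
      funext i
      fin_cases i <;> simp [E] <;> field_simp <;> ring
    rw [this, e1, e2, e3]
    simp
  have hp : ∏ i, (Polynomial.C (a i) + Polynomial.X * Polynomial.C (a' i)) = 0 := by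
    apply Polynomial.funext
    intro t
    obtain ⟨i, hi⟩ := key t
    rw [Polynomial.eval_prod, Polynomial.eval_zero]
    apply Finset.prod_eq_zero (Finset.mem_univ i)
    simp only [Pi.add_apply, Pi.smul_apply, smul_eq_mul] at hi
    simp
    linear_combination hi
  obtain ⟨i, -, hi⟩ := Finset.prod_eq_zero_iff.1 hp
  refine ⟨i, ?_, ?_⟩
  · have := congrArg (Polynomial.eval 0) hi
    simpa using this
  · have := congrArg (Polynomial.eval 1) hi
    have h0 := congrArg (Polynomial.eval 0) hi
    simp at this h0
    simpa [h0] using this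

lemma row_ne {P : Matrix (Fin 3) (Fin 3) K} {M : Matrix (Fin 3) (Fin 3) K} (h : P * M = 1)
    (c : Fin 3 → K) (hc : c ≠ 0) : Matrix.vecMul c P ≠ 0 := by
  intro h0
  apply hc
  rw [← Matrix.vecMul_one c, ← h, ← Matrix.vecMul_vecMul, h0, Matrix.zero_vecMul]

lemma row_ne' {P : Matrix (Fin 3) (Fin 3) K} {M : Matrix (Fin 3) (Fin 3) K} (h : P * M = 1)
    (i j : Fin 3) (hij : i ≠ j) (t : K) : P i + t • P j ≠ 0 := by
  have := row_ne h (Pi.single i 1 + t • Pi.single j 1) (by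
    intro h0
    have := congrFun h0 i
    simp [hij] at this)
  rw [Matrix.add_vecMul, Matrix.smul_vecMul, Matrix.single_one_vecMul,
    Matrix.single_one_vecMul] at this
  exact this

lemma three_prod {u1 u2 u3 v1 v2 v3 : K} (h1 : u1 + v1 = 0) (h2 : u2 + v2 = 0)
    (h3 : u3 + v3 = 0) : u1 * u2 * u3 + v1 * v2 * v3 = 0 := by
  linear_combination h1 * u2 * u3 - v1 * h2 * u3 + v1 * v2 * h3

lemma linalg [Infinite K]
    (hα : α ≠ 0) (hβ : β ≠ 0) (hγ : γ ≠ 0)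
    (hα' : α' ≠ 0) (hβ' : β' ≠ 0) (hγ' : γ' ≠ 0) (h1 : α' * β' * γ' ≠ 1)
    (P R M N : Matrix (Fin 3) (Fin 3) K) (hM : P * M = 1) (hN : R * N = 1)
    (ed : ∀ i, E α' β' γ' (P i) (R i) = 0)
    (e01 : E α' β' γ' (P 0) (R 1) + γ • E α' β' γ' (P 1) (R 0) = 0)
    (e12 : E α' β' γ' (P 1) (R 2) + α • E α' β' γ' (P 2) (R 1) = 0)
    (e20 : E α' β' γ' (P 2) (R 0) + β • E α' β' γ' (P 0) (R 2) = 0) :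
    α' * β' * γ' = α * β * γ ∨ α' * β' * γ' = (α * β * γ)⁻¹ := by
  have c01 := common_zero hγ hα' hβ' hγ' h1 (row_ne' hM 0 1 (by decide))
    (row_ne' hN 0 1 (by decide)) (ed 0) (ed 1) e01
  have c12 := common_zero hα hα' hβ' hγ' h1 (row_ne' hM 1 2 (by decide))
    (row_ne' hN 1 2 (by decide)) (ed 1) (ed 2) e12
  have c20 := common_zero hβ hα' hβ' hγ' h1 (row_ne' hM 2 0 (by decide))
    (row_ne' hN 2 0 (by decide)) (ed 2) (ed 0) e20
  have rP : ∀ i, P i ≠ 0 := by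
    intro i h
    apply row_ne hM (Pi.single i 1) (by simp)
    rw [Matrix.single_one_vecMul]; exact h
  have rR : ∀ i, R i ≠ 0 := by
    intro i h
    apply row_ne hN (Pi.single i 1) (by simp)
    rw [Matrix.single_one_vecMul]; exact h
  have pat : ∀ i j, P i j = 0 ↔ R i j = 0 := fun i =>
    (E_zero hα' hβ' hγ' h1 (rP i) (rR i) (ed i)).1
  have col : ∀ j, ¬ (P 0 j = 0 ∧ P 1 j = 0 ∧ P 2 j = 0) := by
    rintro j ⟨x, y, z⟩
    have h := mul_eq_one_comm.1 hM
    have h2 := congrFun (congrFun h j) j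
    simp [Matrix.mul_apply, Fin.sum_univ_three, x, y, z] at h2
  obtain ⟨i, i0, i1⟩ := c01
  obtain ⟨j, j0, j1⟩ := c12
  obtain ⟨l, l0, l1⟩ := c20
  have hij : i ≠ j := by rintro rfl; exact col i ⟨i0, i1, j1⟩
  have hil : i ≠ l := by rintro rfl; exact col i ⟨i0, i1, l0⟩
  have hjl : j ≠ l := by rintro rfl; exact col j ⟨l1, j0, j1⟩
  have n2 : P 2 i ≠ 0 := fun h => col i ⟨i0, i1, h⟩
  have n0 : P 0 j ≠ 0 := fun h => col j ⟨h, j0, j1⟩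
  have n1 : P 1 l ≠ 0 := fun h => col l ⟨l1, h, l0⟩
  have m2 : R 2 i ≠ 0 := fun h => n2 ((pat _ _).2 h)
  have m0 : R 0 j ≠ 0 := fun h => n0 ((pat _ _).2 h)
  have m1 : R 1 l ≠ 0 := fun h => n1 ((pat _ _).2 h)
  have i0' := (pat _ _).1 i0
  have i1' := (pat _ _).1 i1
  have j0' := (pat _ _).1 j0
  have j1' := (pat _ _).1 j1
  have l0' := (pat _ _).1 l0
  have l1' := (pat _ _).1 l1
  have n : P 0 j * P 1 l * P 2 i * (R 0 j * R 1 l * R 2 i) ≠ 0 :=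
    mul_ne_zero (mul_ne_zero (mul_ne_zero n0 n1) n2) (mul_ne_zero (mul_ne_zero m0 m1) m2)
  have f1 := congrFun e01 i
  have f2 := congrFun e12 j
  have f3 := congrFun e20 l
  clear e01 e12 e20 ed pat col rP rR hM hN
  fin_cases i <;> fin_cases j <;> fin_cases l <;>
    first
    | exact absurd rfl hij
    | exact absurd rfl hil
    | exact absurd rfl hjl
    | (simp [E] at f1 f2 f3 i0 i1 j0 j1 l0 l1 i0' i1' j0' j1' l0' l1'
       simp only [i0, i1, j0, j1, l0, l1, i0', i1', j0', j1', l0', l1', mul_zero,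
         sub_zero, zero_sub] at f1 f2 f3
       simp only [Fin.zero_eta, Fin.mk_one, Fin.reduceFinMk] at n
       have key := three_prod f1 f2 f3
       first
       | (left
          apply mul_right_cancel₀ n
          first
          | linear_combination key
          | linear_combination -key)
       | (right
          apply eq_inv_of_mul_eq_one_left
          apply mul_right_cancel₀ n
          first
          | linear_combination key
          | linear_combination -key))

lemma forward [Infinite K]
    (hα : α ≠ 0) (hβ : β ≠ 0) (hγ : γ ≠ 0)
    (hα' : α' ≠ 0) (hβ' : β' ≠ 0) (hγ' : γ' ≠ 0) (h1 : α' * β' * γ' ≠ 1)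
    (h : TwistEquivalent K (grading K α β γ) (grading K α' β' γ')) :
    α' * β' * γ' = α * β * γ ∨ α' * β' * γ' = (α * β * γ)⁻¹ := by
  obtain ⟨τ, φ, hφ, hφ', -, hmul⟩ := h
  have mat : ∀ f : QuantumP2 K α' β' γ' ≃ₗ[K] QuantumP2 K α β γ,
      (∀ b ∈ grading K α' β' γ' 1, f b ∈ grading K α β γ 1) →
      (∀ a ∈ grading K α β γ 1, f.symm a ∈ grading K α' β' γ' 1) →
      ∃ P M : Matrix (Fin 3) (Fin 3) K, P * M = 1 ∧
        ∀ i, f (gen K α' β' γ' i) = ∑ j, P j i • gen K α β γ j := by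
    intro f hf hf'
    choose p hp using fun i => mem_grading_one (hf _ (gen_mem i))
    choose m hm using fun i => mem_grading_one (hf' _ (gen_mem i))
    refine ⟨Matrix.of fun j i => p i j, Matrix.of fun j i => m i j, ?_, hp⟩
    ext j i
    have e : ∑ j, ((∑ l, m i l * p l j) - (1 : Matrix (Fin 3) (Fin 3) K) j i) •
        gen K α β γ j = 0 := by
      have := congrArg f (hm i)
      rw [LinearEquiv.apply_symm_apply, map_sum] at this
      simp only [map_smul, hp, Finset.smul_sum, smul_smul] at this
      rw [Finset.sum_comm] at this
      simp only [sub_smul, Finset.sum_sub_distrib, Finset.sum_smul]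
      rw [← this]
      simp [Matrix.one_apply]
    have := congrFun (coef_one hβ _ e) j
    simp only [Pi.zero_apply, sub_eq_zero] at this
    rw [← this, Matrix.mul_apply]
    exact Finset.sum_congr rfl fun _ _ => mul_comm _ _
  obtain ⟨P, M, hM, hP⟩ := mat φ (hφ 1) (hφ' 1)
  obtain ⟨R, N, hN, hR⟩ := mat (φ.trans (τ.toFun 1))
    (fun b hb => τ.map_mem 1 1 _ (hφ 1 b hb))
    (fun a ha => hφ' 1 _ (τ.symm_map_mem 1 1 a ha))
  have hprod : ∀ u v, φ (gen K α' β' γ' u * gen K α' β' γ' v) =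
      ∑ i, ∑ j, (P i u * R j v) • (gen K α β γ i * gen K α β γ j) := by
    intro u v
    rw [hmul 1 1 _ _ (gen_mem u) (gen_mem v)]
    have := hR v
    rw [LinearEquiv.trans_apply] at this
    rw [this, hP, Finset.sum_mul_sum]
    simp only [smul_mul_smul_comm]
  have hrel : ∀ u v (c : K), gen K α' β' γ' u * gen K α' β' γ' v =
      c • (gen K α' β' γ' v * gen K α' β' γ' u) →
      ∑ i, ∑ j, (P i u * R j v - c * (P i v * R j u)) • (gen K α β γ i * gen K α β γ j) = 0 := by
    intro u v c h
    have := congrArg φ h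
    rw [map_smul, hprod, hprod] at this
    simp only [sub_smul, Finset.sum_sub_distrib, this, Finset.smul_sum, smul_smul, sub_self]
  obtain ⟨a0, a1, a2, a3⟩ := coef_two hβ _ (hrel 2 1 α' gen_zy)
  obtain ⟨b0, b1, b2, b3⟩ := coef_two hβ _ (hrel 0 2 β' gen_xz)
  obtain ⟨c0, c1, c2, c3⟩ := coef_two hβ _ (hrel 1 0 γ' gen_yx)
  apply linalg hα hβ hγ hα' hβ' hγ' h1 P R M N hM hN
  · intro i
    funext j
    fin_cases j
    · exact a0 i
    · exact b0 i
    · exact c0 i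
  · funext j
    fin_cases j
    · exact a1
    · exact b1
    · exact c1
  · funext j
    fin_cases j
    · exact a2
    · exact b2
    · exact c2
  · funext j
    fin_cases j
    · exact a3
    · exact b3
    · exact c3

end forward

end QuantumP2

/-- For triples `Q = (α,β,γ)` and `Q' = (α',β',γ')` of units with `αβγ ∉ {0,1}` and
`α'β'γ' ∉ {0,1}`, the graded algebras `O_Q(ℙ²)` and `O_{Q'}(ℙ²)` are twist-equivalent
if and only if `α'β'γ' = αβγ` or `α'β'γ' = (αβγ)⁻¹`. -/
theorem quantumP2_twistEquivalent_iff
    (K : Type*) [Field K] [IsAlgClosed K] [CharZero K]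
    (α β γ α' β' γ' : K)
    (hα : α ≠ 0) (hβ : β ≠ 0) (hγ : γ ≠ 0)
    (hα' : α' ≠ 0) (hβ' : β' ≠ 0) (hγ' : γ' ≠ 0)
    (hQ0 : α * β * γ ≠ 0) (hQ1 : α * β * γ ≠ 1)
    (hQ0' : α' * β' * γ' ≠ 0) (hQ1' : α' * β' * γ' ≠ 1) :
    TwistEquivalent K (QuantumP2.grading K α β γ) (QuantumP2.grading K α' β' γ') ↔
      (α' * β' * γ' = α * β * γ ∨ α' * β' * γ' = (α * β * γ)⁻¹) := by
  constructor
  · exact QuantumP2.forward hα hβ hγ hα' hβ' hγ' hQ1'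
  · rintro (h | h)
    · exact QuantumP2.twistEquivalent_of_eq hα hβ hγ hα' hβ' h
    · exact QuantumP2.twistEquivalent_of_inv hα hβ hγ hα' hβ' h
end

section
/- Let k be an algebraically closed field of characteristic 0 and let q, q' ∈ k^× be elements that are not roots of unity. Then the graded algebras O_q(ℙ²) and O_{q'}(ℙ²) are twist-equivalent if and only if q' = q or q' = q^{−1}. -/
/-- The defining relations of quantum projective 2-space `O_q(ℙ²)`:
`x_i x_j = q x_j x_i` for all `i < j`. -/
inductive OqP2Rel (K : Type*) [Field K] (q : K) :
    FreeAlgebra K (Fin 3) → FreeAlgebra K (Fin 3) → Prop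
  | rel (i j : Fin 3) (h : i < j) :
      OqP2Rel K q (FreeAlgebra.ι K i * FreeAlgebra.ι K j)
        (q • (FreeAlgebra.ι K j * FreeAlgebra.ι K i))

/-- Quantum projective 2-space
`O_q(ℙ²) = K⟨x₀,x₁,x₂⟩/⟨x_i x_j − q x_j x_i, i < j⟩`. -/
def OqP2 (K : Type*) [Field K] (q : K) : Type _ := RingQuot (OqP2Rel K q)

noncomputable instance (K : Type*) [Field K] (q : K) : Ring (OqP2 K q) :=
  inferInstanceAs (Ring (RingQuot (OqP2Rel K q)))

noncomputable instance (K : Type*) [Field K] (q : K) : Algebra K (OqP2 K q) :=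
  inferInstanceAs (Algebra K (RingQuot (OqP2Rel K q)))

/-- The images `x₀, x₁, x₂` of the three generators in `O_q(ℙ²)`. -/
noncomputable def OqP2.gen (K : Type*) [Field K] (q : K) (i : Fin 3) : OqP2 K q :=
  RingQuot.mkAlgHom K (OqP2Rel K q) (FreeAlgebra.ι K i)

/-- The standard grading of `O_q(ℙ²)` (`deg xᵢ = 1`): the degree-`m` component is the
`m`-th power of the span of the generators. -/
noncomputable def OqP2.grading (K : Type*) [Field K] (q : K) (m : ℕ) :
    Submodule K (OqP2 K q) :=
  (Submodule.span K (Set.range (OqP2.gen K q))) ^ m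

def PtRel {K : Type*} [Field K] (q : K) (u v : Fin 3 → K) : Prop :=
  ∀ i j : Fin 3, i < j → u i * v j = q * (u j * v i)

theorem PtRel.swap {K : Type*} [Field K] {q : K} (hq : q ≠ 0) {u v : Fin 3 → K}
    (h : PtRel q u v) : PtRel q⁻¹ v u := by
  intro i j hij
  have := h i j hij
  field_simp
  linear_combination -this

/-- Truncated point representation. -/
def ptMat {K : Type*} [Field K] (u v : K) : Matrix (Fin 3) (Fin 3) K :=
  !![0, u, 0; 0, 0, v; 0, 0, 0]

theorem ptMat_mul {K : Type*} [Field K] (u v u' v' : K) :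
    ptMat u v * ptMat u' v' = !![0, 0, u * v'; 0, 0, 0; 0, 0, 0] := by
  ext i j
  fin_cases i <;> fin_cases j <;> simp [ptMat, Matrix.mul_apply, Fin.sum_univ_three]

theorem exists_rep {K : Type*} [Field K] {q : K} {u v : Fin 3 → K} (h : PtRel q u v) :
    ∃ F : OqP2 K q →ₐ[K] Matrix (Fin 3) (Fin 3) K,
      ∀ i, F (OqP2.gen K q i) = ptMat (u i) (v i) := by
  refine ⟨RingQuot.liftAlgHom K ⟨FreeAlgebra.lift K (fun i => ptMat (u i) (v i)), ?_⟩, ?_⟩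
  · rintro _ _ ⟨i, j, hij⟩
    simp only [map_mul, map_smul, FreeAlgebra.lift_ι_apply, ptMat_mul]
    ext a b
    fin_cases a <;> fin_cases b <;> simp [h i j hij]
  · intro i
    unfold OqP2.gen
    erw [RingQuot.liftAlgHom_mkAlgHom_apply]
    simp

theorem rep_sum {K : Type*} [Field K] {q : K} {u v : Fin 3 → K}
    {F : OqP2 K q →ₐ[K] Matrix (Fin 3) (Fin 3) K}
    (hF : ∀ i, F (OqP2.gen K q i) = ptMat (u i) (v i)) (c : Fin 3 → K) :
    F (∑ i, c i • OqP2.gen K q i) = ptMat (∑ i, c i * u i) (∑ i, c i * v i) := by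
  simp only [map_sum, map_smul, hF]
  ext a b
  fin_cases a <;> fin_cases b <;> simp [ptMat, Fin.sum_univ_three]

theorem lin_prod_zero {K : Type*} [Field K] [CharZero K] (a b : Fin 3 → K)
    (h : ∀ y : K, (a 0 + b 0 * y) * (a 1 + b 1 * y) * (a 2 + b 2 * y) = 0) :
    ∃ g, a g = 0 ∧ b g = 0 := by
  have hp : (Polynomial.C (a 0) + Polynomial.C (b 0) * Polynomial.X) *
      (Polynomial.C (a 1) + Polynomial.C (b 1) * Polynomial.X) *
      (Polynomial.C (a 2) + Polynomial.C (b 2) * Polynomial.X) = 0 := by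
    apply Polynomial.funext
    intro y
    simpa using h y
  have key : ∀ g, Polynomial.C (a g) + Polynomial.C (b g) * Polynomial.X = 0 →
      a g = 0 ∧ b g = 0 := by
    intro g hg
    have h0 := congrArg (fun p => Polynomial.coeff p 0) hg
    have h1 := congrArg (fun p => Polynomial.coeff p 1) hg
    simp [Polynomial.coeff_C] at h0 h1
    exact ⟨h0, h1⟩
  rcases mul_eq_zero.1 hp with hp | hp
  · rcases mul_eq_zero.1 hp with hp | hp
    · exact ⟨0, key 0 hp⟩
    · exact ⟨1, key 1 hp⟩
  · exact ⟨2, key 2 hp⟩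

theorem PtRel.triangle {K : Type*} [Field K] {q : K} (hq : q ≠ 0) (hq1 : q ≠ 1)
    {u v : Fin 3 → K} (h : PtRel q u v) (hv : v ≠ 0) : u 0 * u 1 * u 2 = 0 := by
  have h01 := h 0 1 (by decide)
  have h02 := h 0 2 (by decide)
  have h12 := h 1 2 (by decide)
  have hq1' : 1 - q ≠ 0 := sub_ne_zero.2 (Ne.symm hq1)
  have e1 : u 0 * u 2 * v 1 = 0 := by
    apply (mul_eq_zero.1 (_ : (1 - q) * (u 0 * u 2 * v 1) = 0)).resolve_left hq1'
    linear_combination u 2 * h01 - u 1 * h02 + u 0 * h12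
  have e0 : u 1 * u 2 * v 0 = 0 := by
    apply (mul_eq_zero.1 (_ : q * (u 1 * u 2 * v 0) = 0)).resolve_left hq
    linear_combination e1 - u 2 * h01
  have e2 : u 0 * u 1 * v 2 = 0 := by
    linear_combination u 0 * h12 + q * e1
  obtain ⟨i, hi⟩ := Function.ne_iff.1 hv
  have : ∀ i, u 0 * u 1 * u 2 * v i = 0 := by
    intro i
    fin_cases i
    · simp only [Fin.zero_eta]; linear_combination u 0 * e0
    · simp only [Fin.mk_one]; linear_combination u 1 * e1
    · simp only [Fin.reduceFinMk]; linear_combination u 2 * e2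
  exact (mul_eq_zero.1 (this i)).resolve_right hi

def tr {K : Type*} [Field K] (P : Fin 3 → Fin 3 → K) (u : Fin 3 → K) : Fin 3 → K :=
  fun j => ∑ i, P i j * u i

/-- points on an edge of the triangle -/
theorem edge_rel {K : Type*} [Field K] (q x y : K) (a b : Fin 3) (hab : a < b) :
    PtRel q (Pi.single a x + Pi.single b y) (Pi.single a x + Pi.single b (q * y)) := by
  intro i j hij
  fin_cases a <;> fin_cases b <;> first | (exfalso; revert hab; decide) | skip
  all_goals fin_cases i <;> fin_cases j <;> first | (exfalso; revert hij; decide) | skip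
  all_goals simp
  all_goals ring

theorem tr_edge {K : Type*} [Field K] (P : Fin 3 → Fin 3 → K) (x y : K) (a b j : Fin 3) :
    tr P (Pi.single a x + Pi.single b y) j = P a j * x + P b j * y := by
  simp [tr, mul_add, Finset.sum_add_distrib, Pi.single_apply]

theorem mono_edge {K : Type*} [Field K] [CharZero K] {q q' : K} (hq' : q' ≠ 0) (hq1 : q' ≠ 1)
    (P Q : Fin 3 → Fin 3 → K)
    (hPQ : ∀ u v, PtRel q u v → PtRel q' (tr P u) (tr Q v))
    (hQ : ∀ v, tr Q v = 0 → v = 0) (a b : Fin 3) (hab : a < b) :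
    ∃ g, P a g = 0 ∧ P b g = 0 := by
  apply lin_prod_zero
  intro y
  have h := (hPQ _ _ (edge_rel q 1 y a b hab)).triangle hq' hq1 (by
    intro h0
    have := congrFun (hQ _ h0) a
    simp [hab.ne] at this)
  simpa [tr_edge] using h

theorem mono {K : Type*} [Field K] [CharZero K] {q q' : K} (hq' : q' ≠ 0) (hq1 : q' ≠ 1)
    (P Q : Fin 3 → Fin 3 → K)
    (hPQ : ∀ u v, PtRel q u v → PtRel q' (tr P u) (tr Q v))
    (hQ : ∀ v, tr Q v = 0 → v = 0) (hP : ∀ j, ∃ i, P i j ≠ 0) :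
    ∃ g : Fin 3 → Fin 3, Function.Injective g ∧ (∀ i, P i (g i) ≠ 0) ∧
      ∀ i j, j ≠ g i → P i j = 0 := by
  have h : ∀ i, ∃ g, ∀ i', i' ≠ i → P i' g = 0 := by
    intro i
    fin_cases i
    · obtain ⟨g, h1, h2⟩ := mono_edge hq' hq1 P Q hPQ hQ 1 2 (by decide)
      refine ⟨g, fun i' hi' => ?_⟩
      fin_cases i' <;> simp_all
    · obtain ⟨g, h1, h2⟩ := mono_edge hq' hq1 P Q hPQ hQ 0 2 (by decide)
      refine ⟨g, fun i' hi' => ?_⟩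
      fin_cases i' <;> simp_all
    · obtain ⟨g, h1, h2⟩ := mono_edge hq' hq1 P Q hPQ hQ 0 1 (by decide)
      refine ⟨g, fun i' hi' => ?_⟩
      fin_cases i' <;> simp_all
  choose g hg using h
  have hne : ∀ i, P i (g i) ≠ 0 := by
    intro i h0
    obtain ⟨i', hi'⟩ := hP (g i)
    by_cases h : i' = i
    · subst h; exact hi' h0
    · exact hi' (hg i i' h)
  have hinj : Function.Injective g := by
    intro i i' h
    by_contra hc
    apply hne i
    rw [h]
    exact hg i' i hc
  refine ⟨g, hinj, hne, fun i j hj => ?_⟩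
  obtain ⟨i', rfl⟩ := (Finite.injective_iff_surjective.1 hinj) j
  exact hg i' i (fun h => hj (by rw [h]))

theorem perm_final {K : Type*} [Field K] {q q' : K} (hq : q ≠ 0) (hq' : q' ≠ 0)
    (g : Fin 3 → Fin 3) (hg : Function.Injective g) (s : Fin 3 → K) (hs : ∀ i, s i ≠ 0)
    (h1 : ∀ i j, i < j → g i < g j → q * s j = q' * s i)
    (h2 : ∀ i j, i < j → g j < g i → q * s j = q'⁻¹ * s i) : q' = q ∨ q' = q⁻¹ := by
  have key : ∀ w01 w12 w02 : K, q * s 1 = w01 * s 0 → q * s 2 = w12 * s 1 →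
      q * s 2 = w02 * s 0 → q * w02 = w01 * w12 := by
    intro w01 w12 w02 e1 e2 e3
    apply mul_right_cancel₀ (hs 0)
    linear_combination w12 * e1 + q * e2 - q * e3
  have n01 : g 0 ≠ g 1 := fun h => absurd (hg h) (by decide)
  have n12 : g 1 ≠ g 2 := fun h => absurd (hg h) (by decide)
  have n02 : g 0 ≠ g 2 := fun h => absurd (hg h) (by decide)
  rcases lt_or_gt_of_ne n01 with a | a <;> rcases lt_or_gt_of_ne n12 with b | b <;>
    rcases lt_or_gt_of_ne n02 with c | c
  · left
    have := key _ _ _ (h1 0 1 (by decide) a) (h1 1 2 (by decide) b) (h1 0 2 (by decide) c)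
    exact (mul_right_cancel₀ hq' this).symm
  · exact absurd (a.trans b) c.asymm
  · right
    have := key _ _ _ (h1 0 1 (by decide) a) (h2 1 2 (by decide) b) (h1 0 2 (by decide) c)
    field_simp at this ⊢
    linear_combination this
  · left
    have := key _ _ _ (h1 0 1 (by decide) a) (h2 1 2 (by decide) b) (h2 0 2 (by decide) c)
    field_simp at this
    linear_combination -this
  · right
    have := key _ _ _ (h2 0 1 (by decide) a) (h1 1 2 (by decide) b) (h1 0 2 (by decide) c)
    field_simp at this ⊢
    linear_combination this
  · left
    have := key _ _ _ (h2 0 1 (by decide) a) (h1 1 2 (by decide) b) (h2 0 2 (by decide) c)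
    field_simp at this
    linear_combination -this
  · exact absurd (b.trans a) c.asymm
  · right
    have := key _ _ _ (h2 0 1 (by decide) a) (h2 1 2 (by decide) b) (h2 0 2 (by decide) c)
    field_simp at this ⊢
    linear_combination this

theorem matrix_final {K : Type*} [Field K] [CharZero K] {q q' : K} (hq : q ≠ 0)
    (hq' : q' ≠ 0) (hq1 : q' ≠ 1) (P Q : Fin 3 → Fin 3 → K)
    (hPQ : ∀ u v, PtRel q u v → PtRel q' (tr P u) (tr Q v))
    (hP : ∀ v, tr P v = 0 → v = 0) (hQ : ∀ v, tr Q v = 0 → v = 0)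
    (hP' : ∀ j, ∃ i, P i j ≠ 0) (hQ' : ∀ j, ∃ i, Q i j ≠ 0) : q' = q ∨ q' = q⁻¹ := by
  obtain ⟨g, gi, gn, gz⟩ := mono hq' hq1 P Q hPQ hQ hP'
  obtain ⟨f, fi, fn, fz⟩ := mono (q := q⁻¹) (q' := q'⁻¹) (inv_ne_zero hq') (by simpa using hq1)
    Q P (fun u v h => by
      have h' := h.swap (inv_ne_zero hq)
      rw [inv_inv] at h'
      exact (hPQ _ _ h').swap hq') hP hQ'
  have hfg : f = g := by
    funext i
    have hd : PtRel q (Pi.single i 1) (Pi.single i 1) := by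
      intro a b hab
      have : Pi.single (M := fun _ => K) i (1 : K) a * Pi.single (M := fun _ => K) i (1 : K) b = 0 := by
        by_cases h : a = i
        · subst h; simp [hab.ne']
        · simp [h]
      linear_combination (1 - q) * this
    have ht : ∀ (R : Fin 3 → Fin 3 → K) j, tr R (Pi.single i 1) j = R i j := by
      intro R j; simp [tr, Pi.single_apply]
    have h := hPQ _ _ hd
    by_contra hne
    rcases lt_or_gt_of_ne hne with hl | hl
    · have := h _ _ hl
      simp only [ht] at this
      rw [gz i (f i) hne, zero_mul, zero_eq_mul] at this
      rcases this with h | h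
      · exact hq' h
      · exact (mul_ne_zero (gn i) (fn i)) h
    · have := h _ _ hl
      simp only [ht] at this
      rw [gz i (f i) hne, zero_mul, mul_zero] at this
      exact (mul_ne_zero (gn i) (fn i)) this
  subst hfg
  have hrel : ∀ i j, i < j → ∀ a b, a < b →
      (P i a * 1 + P j a * 1) * (Q i b * 1 + Q j b * (q * 1)) =
      q' * ((P i b * 1 + P j b * 1) * (Q i a * 1 + Q j a * (q * 1))) := by
    intro i j hij a b hab
    have := hPQ _ _ (edge_rel q 1 1 i j hij) a b hab
    simpa only [tr_edge] using this
  apply perm_final hq hq' f fi (fun i => Q i (f i) / P i (f i))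
    (fun i => div_ne_zero (fn i) (gn i))
  · intro i j hij hl
    have := hrel i j hij _ _ hl
    rw [gz i _ hl.ne', fz i _ hl.ne', gz j _ hl.ne, fz j _ hl.ne] at this
    have := gn i
    have := gn j
    field_simp
    grind
  · intro i j hij hl
    have := hrel i j hij _ _ hl
    rw [gz i _ hl.ne, fz i _ hl.ne, gz j _ hl.ne', fz j _ hl.ne'] at this
    have := gn i
    have := gn j
    field_simp
    grind

theorem gen_ne_zero {K : Type*} [Field K] (q : K) (i : Fin 3) : OqP2.gen K q i ≠ 0 := by
  intro h
  obtain ⟨F, hF⟩ := exists_rep (q := q) (u := fun _ => (1 : K)) (v := 0) (by intro i j _; simp)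
  have := hF i
  rw [h, map_zero] at this
  have := congrFun (congrFun this 0) 1
  simp [ptMat] at this

theorem mem_grading_one {K : Type*} [Field K] (q : K) (a : OqP2 K q) :
    a ∈ OqP2.grading K q 1 ↔ ∃ c : Fin 3 → K, ∑ i, c i • OqP2.gen K q i = a := by
  rw [OqP2.grading, pow_one, Submodule.mem_span_range_iff_exists_fun]

theorem gen_mem {K : Type*} [Field K] (q : K) (i : Fin 3) :
    OqP2.gen K q i ∈ OqP2.grading K q 1 := by
  rw [OqP2.grading, pow_one]
  exact Submodule.subset_span ⟨i, rfl⟩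

theorem gen_rel {K : Type*} [Field K] (q : K) (i j : Fin 3) (h : i < j) :
    OqP2.gen K q i * OqP2.gen K q j = q • (OqP2.gen K q j * OqP2.gen K q i) := by
  have := RingQuot.mkAlgHom_rel K (OqP2Rel.rel (K := K) (q := q) i j h)
  rw [map_mul, map_smul, map_mul] at this
  exact this

/-- matrix of a graded linear equivalence in degree one -/
theorem exists_matrix {K : Type*} [Field K] {q q' : K} (f : OqP2 K q' ≃ₗ[K] OqP2 K q)
    (hf : ∀ b ∈ OqP2.grading K q' 1, f b ∈ OqP2.grading K q 1)
    (hf' : ∀ b ∈ OqP2.grading K q 1, f.symm b ∈ OqP2.grading K q' 1) :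
    ∃ P : Fin 3 → Fin 3 → K,
      (∀ j, f (OqP2.gen K q' j) = ∑ i, P i j • OqP2.gen K q i) ∧
      (∀ v, tr P v = 0 → v = 0) ∧ (∀ j, ∃ i, P i j ≠ 0) := by
  have h := fun j => (mem_grading_one q _).1 (hf _ (gen_mem q' j))
  choose c hc using h
  refine ⟨fun i j => c j i, fun j => (hc j).symm, ?_, ?_⟩
  · intro v hv
    funext b
    obtain ⟨F, hF⟩ := exists_rep (q := q) (u := v) (v := 0) (by intro i j _; simp)
    obtain ⟨d, hd⟩ := (mem_grading_one q' _).1 (hf' _ (gen_mem q b))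
    have h1 : F (f (∑ i, d i • OqP2.gen K q' i)) = ptMat (v b) 0 := by
      rw [hd, LinearEquiv.apply_symm_apply, hF]; rfl
    rw [map_sum, map_sum] at h1
    have h2 : ∀ i, F (f (d i • OqP2.gen K q' i)) = 0 := by
      intro i
      have h3 := congrFun hv i
      simp only [tr, Pi.zero_apply] at h3
      rw [map_smul, map_smul, ← hc i, rep_sum hF, h3]
      ext a b
      fin_cases a <;> fin_cases b <;> simp [ptMat]
    rw [Finset.sum_eq_zero (fun i _ => h2 i)] at h1
    have := congrFun (congrFun h1 0) 1
    simpa [ptMat] using this.symm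
  · intro j
    by_contra hcon
    push Not at hcon
    apply gen_ne_zero q' j
    apply f.injective
    rw [map_zero, ← hc j]
    simp [hcon]

theorem twist_forward {K : Type*} [Field K] [CharZero K] {q q' : K} (hq : q ≠ 0)
    (hq' : q' ≠ 0) (hq1 : q' ≠ 1)
    (h : TwistEquivalent K (OqP2.grading K q) (OqP2.grading K q')) : q' = q ∨ q' = q⁻¹ := by
  obtain ⟨τ, φ, h1, h2, -, h4⟩ := h
  have hM := fun n => exists_matrix (φ.trans (τ.toFun n))
    (fun b hb => τ.map_mem n 1 _ (h1 1 b hb))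
    (fun b hb => h2 1 _ (τ.symm_map_mem n 1 b hb))
  obtain ⟨P, hP, hP1, hP2⟩ := hM 0
  obtain ⟨Q, hQ, hQ1, hQ2⟩ := hM 1
  refine matrix_final hq hq' hq1 P Q ?_ hP1 hQ1 hP2 hQ2
  intro u v huv i j hij
  obtain ⟨F, hF⟩ := exists_rep huv
  have hm : ∀ a b, τ.toFun 0 (φ (OqP2.gen K q' a * OqP2.gen K q' b)) =
      (∑ i, P i a • OqP2.gen K q i) * ∑ i, Q i b • OqP2.gen K q i := by
    intro a b
    rw [h4 1 1 _ _ (gen_mem q' a) (gen_mem q' b),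
      τ.twist 0 1 _ _ (h1 1 _ (gen_mem q' a)), ← hP, ← hQ]
    simp
  have hr := congrArg (fun z => F (τ.toFun 0 (φ z))) (gen_rel q' i j hij)
  simp only [map_smul] at hr
  rw [hm, hm, map_mul, map_mul, rep_sum hF, rep_sum hF, rep_sum hF, rep_sum hF,
    ptMat_mul, ptMat_mul] at hr
  have := congrFun (congrFun hr 0) 2
  simpa [tr] using this

/-- the trivial twisting system -/
def trivTwist (k : Type*) {A : Type*} [CommSemiring k] [Semiring A]
    [Algebra k A] (𝒜 : ℕ → Submodule k A) : TwistingSystem k 𝒜 where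
  toFun _ := LinearEquiv.refl k A
  map_mem _ _ _ h := h
  symm_map_mem _ _ _ h := h
  twist _ _ _ _ _ := rfl

theorem twist_of_algEquiv {k A B : Type*} [CommSemiring k] [Semiring A] [Algebra k A]
    [Semiring B] [Algebra k B] (𝒜 : ℕ → Submodule k A) (ℬ : ℕ → Submodule k B)
    (e : B ≃ₐ[k] A) (h1 : ∀ m, ∀ b ∈ ℬ m, e b ∈ 𝒜 m) (h2 : ∀ m, ∀ a ∈ 𝒜 m, e.symm a ∈ ℬ m) :
    TwistEquivalent k 𝒜 ℬ :=
  ⟨trivTwist k 𝒜, e.toLinearEquiv, h1, h2, map_one e, fun _ _ a b _ _ => map_mul e a b⟩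

theorem exists_rev {K : Type*} [Field K] {q q' : K} (hq : q ≠ 0) (h : q' = q⁻¹) :
    ∃ F : OqP2 K q' →ₐ[K] OqP2 K q,
      ∀ i, F (OqP2.gen K q' i) = OqP2.gen K q (Fin.rev i) := by
  refine ⟨RingQuot.liftAlgHom K ⟨FreeAlgebra.lift K (fun i => OqP2.gen K q (Fin.rev i)), ?_⟩, ?_⟩
  · rintro _ _ ⟨i, j, hij⟩
    simp only [map_mul, map_smul, FreeAlgebra.lift_ι_apply]
    rw [gen_rel q _ _ (Fin.rev_lt_rev.2 hij), smul_smul, h, inv_mul_cancel₀ hq, one_smul]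
  · intro i
    exact (RingQuot.liftAlgHom_mkAlgHom_apply K _ _ _).trans (FreeAlgebra.lift_ι_apply _ _)

theorem alg_ext {K : Type*} [Field K] {q : K} {B : Type*} [Semiring B] [Algebra K B]
    {F G : OqP2 K q →ₐ[K] B} (h : ∀ i, F (OqP2.gen K q i) = G (OqP2.gen K q i)) : F = G := by
  apply RingQuot.ringQuot_ext'
  apply FreeAlgebra.hom_ext
  funext i
  exact h i

theorem rev_grading {K : Type*} [Field K] {q q' : K} (F : OqP2 K q' →ₐ[K] OqP2 K q)
    (hF : ∀ i, F (OqP2.gen K q' i) = OqP2.gen K q (Fin.rev i)) (m : ℕ) :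
    ∀ b ∈ OqP2.grading K q' m, F b ∈ OqP2.grading K q m := by
  intro b hb
  have h1 : (OqP2.grading K q' m).map F.toLinearMap ≤ OqP2.grading K q m := by
    unfold OqP2.grading
    rw [Submodule.map_pow]
    apply pow_le_pow_left'
    rw [Submodule.map_span, Submodule.span_le]
    rintro _ ⟨_, ⟨i, rfl⟩, rfl⟩
    exact Submodule.subset_span ⟨Fin.rev i, (hF i).symm⟩
  exact h1 ⟨b, hb, rfl⟩

theorem twist_rev {K : Type*} [Field K] {q q' : K} (hq : q ≠ 0) (h : q' = q⁻¹) :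
    TwistEquivalent K (OqP2.grading K q) (OqP2.grading K q') := by
  have hq' : q' ≠ 0 := by rw [h]; exact inv_ne_zero hq
  obtain ⟨F, hF⟩ := exists_rev hq h
  obtain ⟨G, hG⟩ := exists_rev (q := q') (q' := q) hq' (by rw [h, inv_inv])
  refine twist_of_algEquiv _ _ (AlgEquiv.ofAlgHom F G ?_ ?_) (rev_grading F hF) (rev_grading G hG)
  · apply alg_ext; intro i; simp [hF, hG]
  · apply alg_ext; intro i; simp [hF, hG]

/-- Let `q, q' ∈ K^×` not be roots of unity.  Then the graded algebras `O_q(ℙ²)` and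
`O_{q'}(ℙ²)` are twist-equivalent if and only if `q' = q` or `q' = q⁻¹`. -/
theorem OqP2_twistEquivalent_iff
    (K : Type*) [Field K] [IsAlgClosed K] [CharZero K]
    (q q' : K) (hq : q ≠ 0) (hq' : q' ≠ 0)
    (hqru : ∀ m : ℕ, 0 < m → q ^ m ≠ 1) (hqru' : ∀ m : ℕ, 0 < m → q' ^ m ≠ 1) :
    TwistEquivalent K (OqP2.grading K q) (OqP2.grading K q') ↔
      (q' = q ∨ q' = q⁻¹) := by
  constructor
  · intro h
    exact twist_forward hq hq' (by simpa using hqru' 1 one_pos) h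
  · rintro (h | h)
    · subst h
      exact twist_of_algEquiv _ _ AlgEquiv.refl (fun _ _ h => h) (fun _ _ h => h)
    · exact twist_rev hq h
end

section
/- Let k be an algebraically closed field of characteristic 0, let n ≥ 1, and for each two-element subset I = {i₁,i₂} of {0,…,n} (with i₁ < i₂) let λ_I ∈ k^×. Let E ⊂ ℙⁿ(k) be the union of the coordinate lines ℓ_I = {p ∈ ℙⁿ(k) : p_j = 0 for all j ∉ I}, and let μ(λ) : E → E be the map which on each line ℓ_{{i₁,i₂}} multiplies the i₁-th homogeneous coordinate by λ_{{i₁,i₂}} and leaves the i₂-th coordinate unchanged. Then there exists M ∈ GL_{n+1}(k) whose induced automorphism of ℙⁿ(k) agrees with μ(λ) at every point of E if and only if λ_{{i₁,i₂}} = ∏_{k=i₁}^{i₂−1} λ_{{k,k+1}} for all 0 ≤ i₁ < i₂ ≤ n. -/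
/-- Given `λ_{i₁,i₂} ∈ k^×` for pairs `i₁ < i₂` in `{0,…,n}`, there is a matrix
`M ∈ GL_{n+1}(k)` whose induced automorphism of `ℙⁿ(k)` agrees at every point of the
union `E` of the coordinate lines `ℓ_{i₁,i₂}` with the map `μ(λ)` which, on the line
`ℓ_{i₁,i₂}`, multiplies the `i₁`-th homogeneous coordinate by `λ_{i₁,i₂}` and leaves
the `i₂`-th coordinate unchanged, if and only if
`λ_{i₁,i₂} = ∏_{t=i₁}^{i₂−1} λ_{t,t+1}` for all `0 ≤ i₁ < i₂ ≤ n`.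
Points of `ℙⁿ(k)` are described by nonzero homogeneous coordinate vectors, agreement of
two points meaning proportionality by a nonzero scalar; a vector lies on `ℓ_{i₁,i₂}`
precisely when all its coordinates away from `i₁, i₂` vanish. -/
theorem mu_lambda_extends_iff_telescoping
    (k : Type*) [Field k] [IsAlgClosed k] [CharZero k]
    (n : ℕ) (hn : 1 ≤ n) (lam : ℕ → ℕ → k)
    (hlam : ∀ i j : ℕ, i < j → j ≤ n → lam i j ≠ 0) :
    (∃ M : GL (Fin (n + 1)) k, ∀ i₁ i₂ : Fin (n + 1), i₁ < i₂ →
      ∀ v : Fin (n + 1) → k, v ≠ 0 → (∀ j : Fin (n + 1), j ≠ i₁ → j ≠ i₂ → v j = 0) →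
        ∃ c : k, c ≠ 0 ∧
          (M : Matrix (Fin (n + 1)) (Fin (n + 1)) k).mulVec v =
            c • fun j => if j = i₁ then lam (i₁ : ℕ) (i₂ : ℕ) * v i₁ else v j) ↔
    (∀ i₁ i₂ : Fin (n + 1), i₁ < i₂ →
      lam (i₁ : ℕ) (i₂ : ℕ) = ∏ t ∈ Finset.Ico (i₁ : ℕ) (i₂ : ℕ), lam t (t + 1)) := by
  constructor
  · rintro ⟨M, hM⟩
    -- off-diagonal entries vanish, diagonal entries do not
    have key : ∀ a b : Fin (n + 1), a ≠ b →
        (M : Matrix (Fin (n + 1)) (Fin (n + 1)) k) a b = 0 ∧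
        (M : Matrix (Fin (n + 1)) (Fin (n + 1)) k) b b ≠ 0 := by
      intro a b hab
      have hne : (Pi.single b (1 : k) : Fin (n + 1) → k) ≠ 0 := by
        simp
      rcases lt_or_gt_of_ne hab with h | h
      · obtain ⟨c, hc, e⟩ := hM a b h (Pi.single b 1) hne
          (fun j _ h2 => by simp [h2])
        have e1 := congrFun e a
        have e2 := congrFun e b
        simp [hab, hab.symm] at e1 e2
        exact ⟨e1, by rw [e2]; exact hc⟩
      · obtain ⟨c, hc, e⟩ := hM b a h (Pi.single b 1) hne
          (fun j h2 _ => by simp [h2])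
        have e1 := congrFun e a
        have e2 := congrFun e b
        simp [hab] at e1 e2
        exact ⟨e1, by
          rw [e2]; exact mul_ne_zero hc (hlam _ _ h (Nat.lt_succ_iff.mp a.2))⟩
    have rel : ∀ a b : Fin (n + 1), a < b →
        (M : Matrix (Fin (n + 1)) (Fin (n + 1)) k) a a =
          lam a b * (M : Matrix (Fin (n + 1)) (Fin (n + 1)) k) b b := by
      intro a b h
      have hab := h.ne
      obtain ⟨c, hc, e⟩ := hM a b h (Pi.single a 1 + Pi.single b 1)
        (fun h0 => by
          have := congrFun h0 a
          simp [hab] at this)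
        (fun j h1 h2 => by simp [h1, h2])
      have e1 := congrFun e a
      have e2 := congrFun e b
      simp [Matrix.mulVec_add, hab, hab.symm, (key a b hab).1, (key b a hab.symm).1] at e1 e2
      rw [e1, e2, mul_comm]
    have tel : ∀ i : ℕ, ∀ hi : i < n + 1, ∀ j : ℕ, i ≤ j → ∀ hj : j < n + 1,
        (M : Matrix (Fin (n + 1)) (Fin (n + 1)) k) ⟨i, hi⟩ ⟨i, hi⟩ =
          (∏ t ∈ Finset.Ico i j, lam t (t + 1)) *
            (M : Matrix (Fin (n + 1)) (Fin (n + 1)) k) ⟨j, hj⟩ ⟨j, hj⟩ := by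
      intro i hi j hij
      induction j, hij using Nat.le_induction with
      | base => intro hj; simp
      | succ j hij ih =>
        intro hj
        rw [ih (by omega), Finset.prod_Ico_succ_top hij,
          rel ⟨j, by omega⟩ ⟨j + 1, hj⟩ (by simp), mul_assoc]
    intro a b h
    have h1 := tel a a.2 b (le_of_lt h) b.2
    have h2 := rel a b h
    exact mul_right_cancel₀ (key a b h.ne).2 (h2.symm.trans h1)
  · intro H
    let d : Fin (n + 1) → k := fun i => ∏ t ∈ Finset.Ico (i : ℕ) n, lam t (t + 1)
    have hd : ∀ i, d i ≠ 0 := by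
      intro i
      refine Finset.prod_ne_zero_iff.mpr fun t ht => ?_
      have := (Finset.mem_Ico.mp ht).2
      exact hlam _ _ (Nat.lt_succ_self t) this
    have hdet : (Matrix.diagonal d).det ≠ 0 := by
      rw [Matrix.det_diagonal]
      exact Finset.prod_ne_zero_iff.mpr fun i _ => hd i
    refine ⟨Matrix.GeneralLinearGroup.mkOfDetNeZero (Matrix.diagonal d) hdet, ?_⟩
    intro a b h v _ hv
    refine ⟨d b, hd b, ?_⟩
    have hdab : d a = lam a b * d b := by
      rw [H a b h]
      exact (Finset.prod_Ico_consecutive _ (le_of_lt h) (Nat.lt_succ_iff.mp b.2)).symm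
    funext j
    change (Matrix.diagonal d).mulVec v j = _
    rw [Matrix.mulVec_diagonal]
    by_cases hja : j = a
    · subst hja
      simp [hdab]
      ring
    · by_cases hjb : j = b
      · subst hjb
        simp [hja]
      · simp [hja, hv j hja hjb]
end

section
/- Let k be an algebraically closed field of characteristic 0, let n ≥ 2, and let q ∈ k^× not be a root of unity. Let E ⊂ ℙⁿ(k) be the union of the coordinate lines ℓ_I for two-element subsets I of {0,…,n}, and let σ : E → E be the map which on each line ℓ_{{i₁,i₂}} (i₁ < i₂) multiplies the i₂-th homogeneous coordinate by q and leaves the i₁-th coordinate unchanged. Then there is no matrix M ∈ GL_{n+1}(k) whose induced automorphism of ℙⁿ(k) agrees with σ at every point of E. -/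
/-- Let `q ∈ k^×` not be a root of unity and let `n ≥ 2`.  Let `E ⊂ ℙⁿ(k)` be the union
of the coordinate lines `ℓ_{i₁,i₂}` and let `σ : E → E` be the map which, on each line
`ℓ_{i₁,i₂}` (with `i₁ < i₂`), multiplies the `i₂`-th homogeneous coordinate by `q` and
leaves the `i₁`-th coordinate unchanged.  Then there is no matrix `M ∈ GL_{n+1}(k)`
whose induced automorphism of `ℙⁿ(k)` agrees with `σ` at every point of `E`.
Points of `ℙⁿ(k)` are described by nonzero homogeneous coordinate vectors, agreement of
two points meaning proportionality by a nonzero scalar; a vector lies on `ℓ_{i₁,i₂}`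
precisely when all its coordinates away from `i₁, i₂` vanish. -/
theorem quantum_point_scheme_automorphism_does_not_extend
    (k : Type*) [Field k] [IsAlgClosed k] [CharZero k]
    (n : ℕ) (hn : 2 ≤ n) (q : k) (hq : q ≠ 0) (hq' : ∀ m : ℕ, 0 < m → q ^ m ≠ 1) :
    ¬ ∃ M : GL (Fin (n + 1)) k, ∀ i₁ i₂ : Fin (n + 1), i₁ < i₂ →
      ∀ v : Fin (n + 1) → k, v ≠ 0 → (∀ j : Fin (n + 1), j ≠ i₁ → j ≠ i₂ → v j = 0) →
        ∃ c : k, c ≠ 0 ∧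
          (M : Matrix (Fin (n + 1)) (Fin (n + 1)) k).mulVec v =
            c • fun j => if j = i₂ then q * v j else v j := by
  rintro ⟨M, hM⟩
  have key : ∀ i j : Fin (n + 1), i < j →
      (M : Matrix (Fin (n + 1)) (Fin (n + 1)) k) i i ≠ 0 ∧
      (M : Matrix (Fin (n + 1)) (Fin (n + 1)) k) j j =
        q * (M : Matrix (Fin (n + 1)) (Fin (n + 1)) k) i i := by
    intro i j hij
    have hne : i ≠ j := ne_of_lt hij
    have hne' : j ≠ i := hne.symm
    obtain ⟨a, ha, h1⟩ := hM i j hij (Pi.single i 1) (by simp)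
      (fun l hl _ => by simp [hl])
    obtain ⟨b, hb, h2⟩ := hM i j hij (Pi.single j 1) (by simp)
      (fun l _ hl => by simp [hl])
    obtain ⟨c, hc, h3⟩ := hM i j hij (Pi.single i 1 + Pi.single j 1)
      (fun h => by simpa [hne] using congrFun h i)
      (fun l hl hl' => by simp [hl, hl'])
    rw [Matrix.mulVec_add] at h3
    have e1 := congrFun h1 i
    have e2 := congrFun h1 j
    have e3 := congrFun h2 i
    have e5 := congrFun h3 i
    have e6 := congrFun h3 j
    simp [hne, hne'] at e1 e2 e3 e5 e6
    rw [e3, add_zero] at e5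
    rw [e2, zero_add] at e6
    refine ⟨by rw [e5]; exact hc, ?_⟩
    rw [e6, e5, mul_comm]
  obtain ⟨h0, h01⟩ := key ⟨0, by omega⟩ ⟨1, by omega⟩ (Fin.mk_lt_mk.mpr (by norm_num))
  obtain ⟨h1, h12⟩ := key ⟨1, by omega⟩ ⟨2, by omega⟩ (Fin.mk_lt_mk.mpr (by norm_num))
  obtain ⟨_, h02⟩ := key ⟨0, by omega⟩ ⟨2, by omega⟩ (Fin.mk_lt_mk.mpr (by norm_num))
  apply hq' 1 one_pos
  rw [pow_one]
  have h : q * (M : Matrix (Fin (n + 1)) (Fin (n + 1)) k) ⟨1, by omega⟩ ⟨1, by omega⟩ =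
      q * (M : Matrix (Fin (n + 1)) (Fin (n + 1)) k) ⟨0, by omega⟩ ⟨0, by omega⟩ :=
    h12.symm.trans h02
  have h' := mul_left_cancel₀ hq h
  rw [h01] at h'
  exact mul_right_cancel₀ h0 (h'.trans (one_mul _).symm)
end

section
/- Let k be an algebraically closed field of characteristic 0 and let n ≥ 2. Let E ⊂ ℙⁿ(k) be the union of all coordinate lines ℓ_I = {p ∈ ℙⁿ(k) : p_j = 0 for all j ∉ I}, over two-element subsets I of {0,…,n}. Then the subgroup of PGL_{n+1}(k) consisting of those classes whose induced automorphism of ℙⁿ(k) maps E onto E is isomorphic as a group to the semidirect product S_{n+1} ⋉ ((k^×)^{n+1}/k^×), where k^× sits diagonally in (k^×)^{n+1} and the symmetric group S_{n+1} acts by permuting the n+1 coordinates. -/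
/-- The group homomorphism `K^× → GL_{n+1}(K)` sending a unit to the corresponding
scalar matrix; its range is the subgroup of scalar matrices (the diagonal copy of
`K^×`). -/
noncomputable def scalarGL (K : Type*) [Field K] (n : ℕ) : Kˣ →* GL (Fin (n + 1)) K :=
  Units.map (algebraMap K (Matrix (Fin (n + 1)) (Fin (n + 1)) K)).toMonoidHom

instance scalarGL_range_normal (K : Type*) [Field K] (n : ℕ) :
    (scalarGL K n).range.Normal := by
  constructor
  rintro x ⟨c, rfl⟩ g
  refine ⟨c, Units.ext ?_⟩
  show (algebraMap K (Matrix (Fin (n + 1)) (Fin (n + 1)) K) (c : K)) =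
    ((g * scalarGL K n c * g⁻¹ : GL (Fin (n + 1)) K) : Matrix (Fin (n + 1)) (Fin (n + 1)) K)
  rw [Units.val_mul, Units.val_mul]
  show _ = (g : Matrix (Fin (n + 1)) (Fin (n + 1)) K) *
      algebraMap K (Matrix (Fin (n + 1)) (Fin (n + 1)) K) (c : K) * ((g⁻¹ : GL (Fin (n + 1)) K) : Matrix (Fin (n + 1)) (Fin (n + 1)) K)
  rw [← Algebra.commutes, mul_assoc, ← Units.val_mul, mul_inv_cancel, Units.val_one, mul_one]

/-- The projective general linear group `PGL_{n+1}(K) = GL_{n+1}(K)/K^×`. -/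
abbrev PGL (K : Type*) [Field K] (n : ℕ) := GL (Fin (n + 1)) K ⧸ (scalarGL K n).range

/-- A homogeneous coordinate vector lies on the union `E` of the coordinate lines
`ℓ_I`, for two-element subsets `I` of `{0,…,n}`, precisely when all of its coordinates
away from some pair of indices vanish. -/
def OnCoordLines {K : Type*} [Field K] {n : ℕ} (v : Fin (n + 1) → K) : Prop :=
  ∃ i₁ i₂ : Fin (n + 1), i₁ ≠ i₂ ∧ ∀ j : Fin (n + 1), j ≠ i₁ → j ≠ i₂ → v j = 0

/-- A matrix `M ∈ GL_{n+1}(K)` induces an automorphism of `ℙⁿ(K)` mapping the union `E`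
of the coordinate lines onto `E`. -/
def PreservesCoordLines {K : Type*} [Field K] {n : ℕ} (M : GL (Fin (n + 1)) K) : Prop :=
  ∀ v : Fin (n + 1) → K, OnCoordLines v ↔
    OnCoordLines ((M : Matrix (Fin (n + 1)) (Fin (n + 1)) K).mulVec v)

/-- The subgroup of `PGL_{n+1}(K)` of classes whose induced automorphism of `ℙⁿ(K)`
maps the union `E` of the coordinate lines onto `E`. -/
noncomputable def stabE (K : Type*) [Field K] (n : ℕ) : Subgroup (PGL K n) where
  carrier := {g | ∃ M : GL (Fin (n + 1)) K,
    (QuotientGroup.mk M : PGL K n) = g ∧ PreservesCoordLines M}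
  one_mem' := ⟨1, rfl, fun v => by
    simp only [Units.val_one, Matrix.one_mulVec]⟩
  mul_mem' := by
    rintro a b ⟨M, rfl, hM⟩ ⟨M', rfl, hM'⟩
    refine ⟨M * M', rfl, fun v => ?_⟩
    rw [Units.val_mul, ← Matrix.mulVec_mulVec]
    exact (hM' v).trans (hM _)
  inv_mem' := by
    rintro a ⟨M, rfl, hM⟩
    refine ⟨M⁻¹, by rw [QuotientGroup.mk_inv], fun v => ?_⟩
    have h := hM (((M⁻¹ : GL (Fin (n + 1)) K) : Matrix (Fin (n + 1)) (Fin (n + 1)) K).mulVec v)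
    rw [Matrix.mulVec_mulVec, ← Units.val_mul, mul_inv_cancel, Units.val_one,
      Matrix.one_mulVec] at h
    exact h.symm

/-- The diagonal copy of `K^×` inside the torus `(K^×)^{n+1}`. -/
def diagTorus (K : Type*) [Field K] (n : ℕ) : Kˣ →* (Fin (n + 1) → Kˣ) where
  toFun c := fun _ => c
  map_one' := rfl
  map_mul' _ _ := rfl

/-- The quotient torus `(K^×)^{n+1}/K^×`. -/
abbrev TorusQuot (K : Type*) [Field K] (n : ℕ) :=
  (Fin (n + 1) → Kˣ) ⧸ (diagTorus K n).range

/-- The symmetric group `S_{n+1}` acts on the torus `(K^×)^{n+1}` by permuting the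
coordinates. -/
def permTorus (K : Type*) [Field K] (n : ℕ) (σ : Equiv.Perm (Fin (n + 1))) :
    MulAut (Fin (n + 1) → Kˣ) :=
  MulEquiv.arrowCongr σ (MulEquiv.refl Kˣ)

lemma permTorus_map_diag (K : Type*) [Field K] (n : ℕ) (σ : Equiv.Perm (Fin (n + 1))) :
    (diagTorus K n).range.map (permTorus K n σ) = (diagTorus K n).range := by
  rw [← MonoidHom.range_comp]
  congr 1

/-- The permutation action of `S_{n+1}` on the quotient torus `(K^×)^{n+1}/K^×`. -/
def permTorusQuot (K : Type*) [Field K] (n : ℕ) :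
    Equiv.Perm (Fin (n + 1)) →* MulAut (TorusQuot K n) where
  toFun σ := QuotientGroup.congr (diagTorus K n).range (diagTorus K n).range
    (permTorus K n σ) (permTorus_map_diag K n σ)
  map_one' := by
    ext x
    refine QuotientGroup.induction_on x fun f => ?_
    rfl
  map_mul' σ σ' := by
    ext x
    refine QuotientGroup.induction_on x fun f => ?_
    rfl

namespace StabEAux

open Matrix

variable {K : Type*} [Field K] {n : ℕ}

/-- Three distinct nonzero coordinates: not on the coordinate lines. -/
lemma not_on {v : Fin (n + 1) → K} {p q r : Fin (n + 1)} (hpq : p ≠ q) (hpr : p ≠ r)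
    (hqr : q ≠ r) (hp : v p ≠ 0) (hq : v q ≠ 0) (hr : v r ≠ 0) : ¬ OnCoordLines v := by
  rintro ⟨a, b, hab, h⟩
  have h1 : p = a ∨ p = b := by
    by_contra hc; push Not at hc; exact hp (h p hc.1 hc.2)
  have h2 : q = a ∨ q = b := by
    by_contra hc; push Not at hc; exact hq (h q hc.1 hc.2)
  have h3 : r = a ∨ r = b := by
    by_contra hc; push Not at hc; exact hr (h r hc.1 hc.2)
  grind

/-- Diagonal matrices. -/
noncomputable def D (K : Type*) [Field K] (n : ℕ) : (Fin (n + 1) → Kˣ) →* GL (Fin (n + 1)) K :=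
  MonoidHom.toHomUnits
    { toFun := fun f => Matrix.diagonal fun i => (f i : K)
      map_one' := by simp
      map_mul' := fun f g => by simp [Matrix.diagonal_mul_diagonal] }

/-- Permutation matrices. -/
noncomputable def P (K : Type*) [Field K] (n : ℕ) :
    Equiv.Perm (Fin (n + 1)) →* GL (Fin (n + 1)) K :=
  MonoidHom.toHomUnits
    { toFun := fun σ => (Matrix.of fun r c => if r = σ c then (1 : K) else 0 :
        Matrix (Fin (n + 1)) (Fin (n + 1)) K)
      map_one' := by ext r c; simp [Matrix.one_apply]; congr
      map_mul' := fun f g => by ext r c; simp [Matrix.mul_apply]; congr }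

lemma D_apply (f : Fin (n + 1) → Kˣ) (r c : Fin (n + 1)) :
    (D K n f : Matrix (Fin (n + 1)) (Fin (n + 1)) K) r c = if r = c then (f r : K) else 0 := by
  simp [D, Matrix.diagonal_apply]

lemma P_apply (σ : Equiv.Perm (Fin (n + 1))) (r c : Fin (n + 1)) :
    (P K n σ : Matrix (Fin (n + 1)) (Fin (n + 1)) K) r c = if r = σ c then 1 else 0 := by
  simp [P]

lemma DP_apply (f : Fin (n + 1) → Kˣ) (σ : Equiv.Perm (Fin (n + 1))) (r c : Fin (n + 1)) :
    ((D K n f * P K n σ : GL (Fin (n + 1)) K) : Matrix (Fin (n + 1)) (Fin (n + 1)) K) r c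
      = if r = σ c then (f r : K) else 0 := by
  simp [Matrix.mul_apply, D_apply, P_apply]

lemma PD (f : Fin (n + 1) → Kˣ) (σ : Equiv.Perm (Fin (n + 1))) :
    P K n σ * D K n f = D K n (permTorus K n σ f) * P K n σ := by
  ext r c
  rw [DP_apply]
  have : (permTorus K n σ f) r = f (σ.symm r) := rfl
  simp only [Units.val_mul, Matrix.mul_apply, D_apply, P_apply, this]
  by_cases h : r = σ c
  · subst h; simp
  · simp [h]

lemma scalar_apply (a : Kˣ) (r c : Fin (n + 1)) :
    (scalarGL K n a : Matrix (Fin (n + 1)) (Fin (n + 1)) K) r c = if r = c then (a : K) else 0 := by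
  simp [scalarGL, Matrix.algebraMap_matrix_apply]

lemma DP_mulVec (f : Fin (n + 1) → Kˣ) (σ : Equiv.Perm (Fin (n + 1))) (v : Fin (n + 1) → K)
    (r : Fin (n + 1)) :
    (((D K n f * P K n σ : GL (Fin (n + 1)) K) : Matrix (Fin (n + 1)) (Fin (n + 1)) K) *ᵥ v) r
      = f r * v (σ.symm r) := by
  simp only [Matrix.mulVec, dotProduct, DP_apply]
  rw [Finset.sum_eq_single (σ.symm r)]
  · simp
  · intro b _ hb
    rw [if_neg, zero_mul]
    rintro rfl
    simp at hb
  · simp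

lemma DP_preserves (f : Fin (n + 1) → Kˣ) (σ : Equiv.Perm (Fin (n + 1))) :
    PreservesCoordLines (D K n f * P K n σ) := by
  intro v
  constructor
  · rintro ⟨a, b, hab, h⟩
    refine ⟨σ a, σ b, by simpa using hab, fun j ha hb => ?_⟩
    rw [DP_mulVec, h, mul_zero]
    · rintro rfl; simp at ha
    · rintro rfl; simp at hb
  · rintro ⟨a, b, hab, h⟩
    refine ⟨σ.symm a, σ.symm b, by simpa using hab, fun j ha hb => ?_⟩
    have := h (σ j) (by rintro rfl; simp at ha) (by rintro rfl; simp at hb)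
    rw [DP_mulVec] at this
    simpa using this

lemma row_ne (M : GL (Fin (n + 1)) K) (r : Fin (n + 1)) : ∃ j, (M : Matrix (Fin (n + 1)) (Fin (n + 1)) K) r j ≠ 0 := by
  by_contra! h
  have h1 : ((M : Matrix (Fin (n + 1)) (Fin (n + 1)) K) * ((M⁻¹ : GL (Fin (n + 1)) K) : Matrix (Fin (n + 1)) (Fin (n + 1)) K)) r r = 1 := by
    rw [← Units.val_mul, mul_inv_cancel, Units.val_one, Matrix.one_apply_eq]
  simp [Matrix.mul_apply, h] at h1

lemma col_ne (M : GL (Fin (n + 1)) K) (c : Fin (n + 1)) : ∃ i, (M : Matrix (Fin (n + 1)) (Fin (n + 1)) K) i c ≠ 0 := by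
  by_contra! h
  have h1 : (((M⁻¹ : GL (Fin (n + 1)) K) : Matrix (Fin (n + 1)) (Fin (n + 1)) K) * (M : Matrix (Fin (n + 1)) (Fin (n + 1)) K)) c c = 1 := by
    rw [← Units.val_mul, inv_mul_cancel, Units.val_one, Matrix.one_apply_eq]
  simp only [Matrix.mul_apply, h] at h1
  simp at h1

lemma bad {a b t : K} (h : a ≠ 0 ∨ b ≠ 0) (ht : t ≠ -a / b) : a + t * b ≠ 0 := by
  intro h0
  by_cases hb : b = 0
  · simp_all
  · apply ht
    field_simp
    linear_combination h0

lemma on_pair (hn : 2 ≤ n) (i j : Fin (n + 1)) (t : K) :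
    OnCoordLines (Pi.single i 1 + t • Pi.single j 1 : Fin (n + 1) → K) := by
  by_cases hij : i = j
  · subst hij
    have : Nontrivial (Fin (n + 1)) := Fin.nontrivial_iff_two_le.2 (by omega)
    obtain ⟨k, hk⟩ := exists_ne i
    exact ⟨i, k, hk.symm, fun l h1 h2 => by simp [h1]⟩
  · exact ⟨i, j, hij, fun l h1 h2 => by simp [h1, h2]⟩

lemma col_unique [Infinite K] (hn : 2 ≤ n) (M : GL (Fin (n + 1)) K) (hM : PreservesCoordLines M)
    (i p q : Fin (n + 1)) (hp : (M : Matrix (Fin (n + 1)) (Fin (n + 1)) K) p i ≠ 0) (hq : (M : Matrix (Fin (n + 1)) (Fin (n + 1)) K) q i ≠ 0) :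
    p = q := by
  by_contra hpq
  obtain ⟨r, hr⟩ : ∃ r, r ∉ ({p, q} : Finset (Fin (n + 1))) := by
    by_contra! h
    have h1 := Finset.card_le_card (fun x _ => h x : Finset.univ ⊆ ({p, q} : Finset (Fin (n + 1))))
    have h2 := Finset.card_le_two (a := p) (b := q)
    rw [Finset.card_univ, Fintype.card_fin] at h1
    omega
  simp only [Finset.mem_insert, Finset.mem_singleton, not_or] at hr
  obtain ⟨j, hj⟩ := row_ne M r
  classical
  let g : Fin (n + 1) → K := fun x => -(M : Matrix (Fin (n + 1)) (Fin (n + 1)) K) x i / (M : Matrix (Fin (n + 1)) (Fin (n + 1)) K) x j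
  obtain ⟨t, ht⟩ := Infinite.exists_notMem_finset ({g p, g q, g r} : Finset K)
  simp only [Finset.mem_insert, Finset.mem_singleton, not_or] at ht
  have key := (hM _).1 (on_pair hn i j t)
  have hv : ∀ x, ((M : Matrix (Fin (n + 1)) (Fin (n + 1)) K) *ᵥ (Pi.single i 1 + t • Pi.single j 1)) x
      = (M : Matrix (Fin (n + 1)) (Fin (n + 1)) K) x i + t * (M : Matrix (Fin (n + 1)) (Fin (n + 1)) K) x j := by
    intro x
    simp [Matrix.mulVec_add, Matrix.mulVec_smul]
  refine not_on hpq (Ne.symm hr.1) (Ne.symm hr.2) ?_ ?_ ?_ key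
  · rw [hv]; exact bad (Or.inl hp) ht.1
  · rw [hv]; exact bad (Or.inl hq) ht.2.1
  · rw [hv]; exact bad (Or.inr hj) ht.2.2

lemma monomial [Infinite K] (hn : 2 ≤ n) (M : GL (Fin (n + 1)) K) (hM : PreservesCoordLines M) :
    ∃ f σ, D K n f * P K n σ = M := by
  choose s hs using col_ne M
  have hu : ∀ i r, (M : Matrix (Fin (n + 1)) (Fin (n + 1)) K) r i ≠ 0 → r = s i := fun i r h =>
    col_unique hn M hM i r (s i) h (hs i)
  have hsurj : Function.Surjective s := fun r => by
    obtain ⟨j, hj⟩ := row_ne M r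
    exact ⟨j, (hu j r hj).symm⟩
  let σ : Equiv.Perm (Fin (n + 1)) :=
    Equiv.ofBijective s (Finite.surjective_iff_bijective.1 hsurj)
  have hσ : ∀ i, σ i = s i := fun i => rfl
  refine ⟨fun r => Units.mk0 ((M : Matrix (Fin (n + 1)) (Fin (n + 1)) K) (s (σ.symm r)) (σ.symm r)) (hs _), σ, ?_⟩
  ext r c
  rw [DP_apply]
  split_ifs with h
  · subst h
    simp only [Units.val_mk0, Equiv.symm_apply_apply, hσ c]
    rw [← hσ c, Equiv.symm_apply_apply, hσ c]
  · by_contra hne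
    exact h (hu c r (Ne.symm hne))

/-- Torus quotient into PGL. -/
noncomputable def Dq (K : Type*) [Field K] (n : ℕ) : TorusQuot K n →* PGL K n :=
  QuotientGroup.map _ _ (D K n) (by
    rintro _ ⟨a, rfl⟩
    refine ⟨a, ?_⟩
    ext r c
    rw [scalar_apply, D_apply]
    rfl)

/-- The homomorphism from the semidirect product to PGL. -/
noncomputable def Phi (K : Type*) [Field K] (n : ℕ) :
    (TorusQuot K n ⋊[permTorusQuot K n] Equiv.Perm (Fin (n + 1))) →* PGL K n :=
  SemidirectProduct.lift (Dq K n) ((QuotientGroup.mk' _).comp (P K n)) (by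
    intro σ
    ext x
    show (QuotientGroup.mk (D K n (permTorus K n σ x)) : PGL K n) =
      QuotientGroup.mk (P K n σ * D K n x * (P K n σ)⁻¹)
    rw [PD, mul_inv_cancel_right])

lemma Phi_apply (f : Fin (n + 1) → Kˣ) (σ : Equiv.Perm (Fin (n + 1))) :
    Phi K n ⟨QuotientGroup.mk f, σ⟩ = QuotientGroup.mk (D K n f * P K n σ) := rfl

lemma Phi_injective : Function.Injective (Phi K n) := by
  rw [injective_iff_map_eq_one]
  rintro ⟨x, σ⟩ h
  obtain ⟨f, rfl⟩ := QuotientGroup.mk_surjective x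
  rw [Phi_apply, QuotientGroup.eq_one_iff] at h
  obtain ⟨a, ha⟩ := h
  have hent : ∀ r c, (if r = c then (a : K) else 0) = if r = σ c then (f r : K) else 0 := by
    intro r c
    rw [← DP_apply, ← ha, scalar_apply]
  have hσ : ∀ i, σ i = i := by
    intro i
    have := hent i i
    by_contra hne
    rw [if_pos rfl, if_neg (Ne.symm hne)] at this
    exact a.ne_zero this
  have hσ1 : σ = 1 := Equiv.ext hσ
  subst hσ1
  have hf : (QuotientGroup.mk f : TorusQuot K n) = 1 := by
    rw [QuotientGroup.eq_one_iff]
    refine ⟨a, funext fun i => Units.ext ?_⟩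
    have := hent i i
    rw [if_pos rfl, if_pos (hσ i).symm] at this
    exact this
  rw [hf]
  rfl

lemma Phi_range [Infinite K] (hn : 2 ≤ n) : (Phi K n).range = stabE K n := by
  ext g
  constructor
  · rintro ⟨⟨x, σ⟩, rfl⟩
    obtain ⟨f, rfl⟩ := QuotientGroup.mk_surjective x
    exact ⟨_, rfl, DP_preserves f σ⟩
  · rintro ⟨M, rfl, hM⟩
    obtain ⟨f, σ, rfl⟩ := monomial hn M hM
    exact ⟨⟨QuotientGroup.mk f, σ⟩, Phi_apply f σ⟩

end StabEAux

/-- The subgroup of `PGL_{n+1}(K)` of classes mapping the union `E ⊂ ℙⁿ(K)` of the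
coordinate lines onto `E` is isomorphic as a group to the semidirect product
`S_{n+1} ⋉ ((K^×)^{n+1}/K^×)`, where `K^×` sits diagonally in the torus `(K^×)^{n+1}`
and `S_{n+1}` acts by permuting the `n+1` coordinates. -/
theorem stabE_iso_semidirect (K : Type*) [Field K] [IsAlgClosed K] [CharZero K]
    (n : ℕ) (hn : 2 ≤ n) :
    Nonempty (stabE K n ≃* (TorusQuot K n ⋊[permTorusQuot K n] Equiv.Perm (Fin (n + 1)))) := by
  have : Infinite K := CharZero.infinite K
  exact ⟨((MonoidHom.ofInjective (StabEAux.Phi_injective (K := K) (n := n))).trans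
    (MulEquiv.subgroupCongr (StabEAux.Phi_range hn))).symm⟩
end

section
/- Let k be an algebraically closed field of characteristic 0, let n ≥ 0, and let A = k[x₀,…,x_n] be the polynomial ring with its standard grading. Each σ ∈ GL_{n+1}(k) acts linearly on A₁ = span(x₀,…,x_n) and extends uniquely to a graded algebra automorphism of A; let A^σ denote the twist of A by σ, i.e. the graded vector space A with multiplication a ⋆ b = a·σ^m(b) for a ∈ A_m. Then for σ, σ' ∈ GL_{n+1}(k), the graded algebras A^σ and A^{σ'} are isomorphic if and only if the images of σ and σ' in PGL_{n+1}(k) = GL_{n+1}(k)/k^× are conjugate. -/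
/-- The graded algebra automorphism of the polynomial ring `K[x₀,…,x_n]` induced by a
matrix `σ ∈ GL_{n+1}(K)` acting linearly on the span of the variables. -/
noncomputable def glAut (K : Type*) [Field K] (n : ℕ) (σ : GL (Fin (n + 1)) K) :
    MvPolynomial (Fin (n + 1)) K →ₐ[K] MvPolynomial (Fin (n + 1)) K :=
  MvPolynomial.aeval fun i =>
    ∑ j, (σ : Matrix (Fin (n + 1)) (Fin (n + 1)) K) i j • MvPolynomial.X j

namespace TwistAux

open MvPolynomial Matrix

variable {K : Type*} [Field K] {n : ℕ}

/-- The linear form with coefficient vector `v`. -/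
noncomputable def lin (v : Fin (n + 1) → K) : MvPolynomial (Fin (n + 1)) K :=
  ∑ j, v j • X j

/-- Substitution by an arbitrary matrix. -/
noncomputable def mAut (M : Matrix (Fin (n + 1)) (Fin (n + 1)) K) :
    MvPolynomial (Fin (n + 1)) K →ₐ[K] MvPolynomial (Fin (n + 1)) K :=
  aeval fun i => lin (M i)

lemma glAut_eq (σ : GL (Fin (n + 1)) K) :
    glAut K n σ = mAut (σ : Matrix (Fin (n + 1)) (Fin (n + 1)) K) := rfl

lemma lin_hom (v : Fin (n + 1) → K) : (lin v).IsHomogeneous 1 := by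
  unfold lin
  refine IsHomogeneous.sum _ _ _ fun i _ => ?_
  rw [smul_eq_C_mul]
  simpa using (isHomogeneous_C _ (v i)).mul (isHomogeneous_X K i)

lemma lin_single (i : Fin (n + 1)) : lin (Pi.single i (1 : K)) = X i := by
  unfold lin
  rw [Finset.sum_eq_single i] <;> simp +contextual [Pi.single_apply]

lemma eval_lin (p v : Fin (n + 1) → K) : eval p (lin v) = v ⬝ᵥ p := by
  simp [lin, dotProduct, smul_eval]

lemma lin_inj {v w : Fin (n + 1) → K} (h : lin v = lin w) : v = w := by
  funext i
  have := congrArg (eval (Pi.single i 1)) h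
  simpa [eval_lin] using this

lemma linear_lin {f : MvPolynomial (Fin (n + 1)) K →ₗ[K] MvPolynomial (Fin (n + 1)) K}
    {F : Matrix (Fin (n + 1)) (Fin (n + 1)) K} (hf : ∀ i, f (X i) = lin (F i))
    (v : Fin (n + 1) → K) : f (lin v) = lin (v ᵥ* F) := by
  simp only [lin, map_sum, map_smul, hf, Finset.smul_sum, vecMul, dotProduct, Finset.sum_smul,
    smul_smul]
  rw [Finset.sum_comm]

lemma mAut_X (M : Matrix (Fin (n + 1)) (Fin (n + 1)) K) (i) : mAut M (X i) = lin (M i) := by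
  simp [mAut]

lemma mAut_lin (M : Matrix (Fin (n + 1)) (Fin (n + 1)) K) (v : Fin (n + 1) → K) :
    mAut M (lin v) = lin (v ᵥ* M) :=
  linear_lin (f := (mAut M).toLinearMap) (mAut_X M) v

lemma mAut_mul (M N : Matrix (Fin (n + 1)) (Fin (n + 1)) K) (b) :
    mAut (M * N) b = mAut N (mAut M b) := by
  have : mAut (M * N) = (mAut N).comp (mAut M) := by
    ext1 i
    rw [AlgHom.comp_apply, mAut_X, mAut_X, mAut_lin]
    rfl
  rw [this]; rfl

lemma mAut_one (b : MvPolynomial (Fin (n + 1)) K) : mAut 1 b = b := by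
  have : mAut (1 : Matrix (Fin (n + 1)) (Fin (n + 1)) K) = AlgHom.id K _ := by
    ext1 i
    rw [mAut_X, AlgHom.id_apply, ← lin_single]
    congr 1
    funext j
    simp [Matrix.one_apply, Pi.single_apply, eq_comm]
  rw [this]; rfl

lemma mAut_hom (M : Matrix (Fin (n + 1)) (Fin (n + 1)) K) {m : ℕ}
    {b : MvPolynomial (Fin (n + 1)) K} (hb : b.IsHomogeneous m) :
    (mAut M b).IsHomogeneous m := by
  have := hb.aeval (fun i => lin (M i)) (n := 1) (fun i => lin_hom _)
  simpa [mAut] using this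

lemma mAut_scalar (c : K) {l : ℕ} {b : MvPolynomial (Fin (n + 1)) K} (hb : b.IsHomogeneous l) :
    mAut (c • (1 : Matrix (Fin (n + 1)) (Fin (n + 1)) K)) b = c ^ l • b := by
  have hX : ∀ i, mAut (c • (1 : Matrix (Fin (n + 1)) (Fin (n + 1)) K)) (X i) = c • X i := by
    intro i
    rw [← lin_single, mAut_lin]
    rw [Matrix.vecMul_smul, Matrix.vecMul_one]
    simp only [lin, Finset.smul_sum, smul_smul, Pi.smul_apply, smul_eq_mul]
  rw [b.as_sum, map_sum, Finset.smul_sum]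
  refine Finset.sum_congr rfl fun d hd => ?_
  have hd' : d.degree = l := by
    have := hb (mem_support_iff.1 hd)
    rwa [Finsupp.degree_eq_weight_one]
  rw [monomial_eq, map_mul, Finsupp.prod, map_prod]
  simp only [map_pow, hX, smul_pow, Finset.prod_smul, algHom_C]
  rw [Finset.prod_pow_eq_pow_sum, ← hd', mul_smul_comm]
  rfl

lemma mAut_smul (c : K) (M : Matrix (Fin (n + 1)) (Fin (n + 1)) K) {l : ℕ}
    {b : MvPolynomial (Fin (n + 1)) K} (hb : b.IsHomogeneous l) :
    mAut (c • M) b = c ^ l • mAut M b := by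
  have : c • M = (c • (1 : Matrix (Fin (n + 1)) (Fin (n + 1)) K)) * M := by simp
  rw [this, mAut_mul, mAut_scalar c hb, map_smul]

lemma pow_comm_rel {S T F : Matrix (Fin (n + 1)) (Fin (n + 1)) K} {c : K}
    (h : S * F = c • (F * T)) (m : ℕ) {l : ℕ}
    {b : MvPolynomial (Fin (n + 1)) K} (hb : b.IsHomogeneous l) :
    mAut F ((mAut S ^ m) b) = c ^ (m * l) • (mAut T ^ m) (mAut F b) := by
  induction m generalizing b with
  | zero => simp
  | succ m ih =>
    rw [pow_succ, pow_succ, AlgHom.mul_apply, AlgHom.mul_apply, ih (mAut_hom S hb), ← mAut_mul, h,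
      mAut_smul c _ hb, mAut_mul, map_smul, smul_smul, ← pow_add]
    congr 2; ring

/-- Degreewise scaling. -/
noncomputable def scal (t : ℕ → Kˣ) :
    MvPolynomial (Fin (n + 1)) K ≃ₗ[K] MvPolynomial (Fin (n + 1)) K :=
  (basisMonomials (Fin (n + 1)) K).equiv
    ((basisMonomials (Fin (n + 1)) K).unitsSMul fun d => t d.degree) (Equiv.refl _)

lemma scal_hom (t : ℕ → Kˣ) {l : ℕ} {b : MvPolynomial (Fin (n + 1)) K} (hb : b.IsHomogeneous l) :
    scal t b = (t l : K) • b := by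
  rw [b.as_sum, map_sum, Finset.smul_sum]
  refine Finset.sum_congr rfl fun d hd => ?_
  have hd' : d.degree = l := by
    have := hb (mem_support_iff.1 hd)
    rwa [Finsupp.degree_eq_weight_one]
  have h1 : monomial d (coeff d b) = coeff d b • basisMonomials (Fin (n + 1)) K d := by
    simp [smul_monomial]
  rw [h1, map_smul, scal, Module.Basis.equiv_apply, Equiv.refl_apply,
    Module.Basis.unitsSMul_apply, hd', smul_comm, Units.smul_def]

lemma scal_symm_hom (t : ℕ → Kˣ) {l : ℕ} {b : MvPolynomial (Fin (n + 1)) K}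
    (hb : b.IsHomogeneous l) : (scal t).symm b = ((t l)⁻¹ : K) • b := by
  rw [LinearEquiv.symm_apply_eq, map_smul, scal_hom t hb, smul_smul, inv_mul_cancel₀ (t l).ne_zero,
    one_smul]

/-- `mAut` as a linear equivalence. -/
noncomputable def mEquiv (F G : Matrix (Fin (n + 1)) (Fin (n + 1)) K) (h : F * G = 1)
    (h' : G * F = 1) :
    MvPolynomial (Fin (n + 1)) K ≃ₗ[K] MvPolynomial (Fin (n + 1)) K :=
  LinearEquiv.ofLinearMap (mAut F).toLinearMap (mAut G).toLinearMap
    (by ext1 d; ext1; simp [← mAut_mul, h', mAut_one])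
    (by ext1 d; ext1; simp [← mAut_mul, h, mAut_one])

lemma choose_two (m l : ℕ) : (m + l).choose 2 = m.choose 2 + l.choose 2 + m * l := by
  induction l with
  | zero => simp
  | succ l ih =>
    rw [← add_assoc, Nat.choose_succ_succ' (m + l) 1, Nat.choose_succ_succ' l 1, ih]
    simp; ring

lemma exists_lin {a : MvPolynomial (Fin (n + 1)) K} (ha : a.IsHomogeneous 1) :
    ∃ v, a = lin v := by
  have h : a ∈ Submodule.span K (Set.range (X : Fin (n + 1) → MvPolynomial (Fin (n + 1)) K)) := by
    rw [← homogeneousSubmodule_one_eq_span_X]; exact ha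
  obtain ⟨v, hv⟩ := (Submodule.mem_span_range_iff_exists_fun K).1 h
  exact ⟨v, hv.symm⟩

lemma scalar_of_comm {H : Matrix (Fin (n + 1)) (Fin (n + 1)) K}
    (h : ∀ x y : Fin (n + 1) → K, lin x * lin (y ᵥ* H) = lin y * lin (x ᵥ* H)) :
    H = H 0 0 • (1 : Matrix (Fin (n + 1)) (Fin (n + 1)) K) := by
  have h' : ∀ i j (p : Fin (n + 1) → K), p i * (H j ⬝ᵥ p) = p j * (H i ⬝ᵥ p) := by
    intro i j p
    have := congrArg (eval p) (h (Pi.single i 1) (Pi.single j 1))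
    simpa [eval_lin, Matrix.row] using this
  have hoff : ∀ i j, i ≠ j → H j i = 0 := by
    intro i j hij
    have := h' i j (Pi.single i 1)
    simpa [Pi.single_apply, hij.symm] using this
  have hdiag : ∀ i j, i ≠ j → H j j = H i i := by
    intro i j hij
    have := h' i j (Pi.single i 1 + Pi.single j 1)
    simpa [dotProduct_add, Pi.single_apply, hij, hij.symm, hoff i j hij, hoff j i hij.symm] using this
  ext i j
  by_cases hij : i = j
  · subst hij
    by_cases h0 : i = 0
    · subst h0; simp
    · simpa using hdiag 0 i (Ne.symm h0)
  · simp [hij, hoff j i (Ne.symm hij)]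

end TwistAux

/-- Let `A = K[x₀,…,x_n]` with its standard grading, and for `σ ∈ GL_{n+1}(K)` let
`A^σ` be the twist of `A` by `σ`, i.e. the graded vector space `A` with multiplication
`a ⋆ b = a·σ^m(b)` for `a ∈ A_m`.  Then `A^σ` and `A^{σ'}` are isomorphic as graded
algebras (there is a degree-preserving linear equivalence `φ` with `φ(1) = 1` and
`φ(a ⋆_σ b) = φ(a) ⋆_{σ'} φ(b)`) if and only if the images of `σ` and `σ'` in
`PGL_{n+1}(K) = GL_{n+1}(K)/K^×` are conjugate. -/
theorem polynomial_twists_iso_iff_conjugate_in_PGL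
    (K : Type*) [Field K] [IsAlgClosed K] [CharZero K] (n : ℕ)
    (σ σ' : GL (Fin (n + 1)) K) :
    (∃ φ : MvPolynomial (Fin (n + 1)) K ≃ₗ[K] MvPolynomial (Fin (n + 1)) K,
      (∀ m : ℕ, ∀ a ∈ MvPolynomial.homogeneousSubmodule (Fin (n + 1)) K m,
        φ a ∈ MvPolynomial.homogeneousSubmodule (Fin (n + 1)) K m) ∧
      (∀ m : ℕ, ∀ a ∈ MvPolynomial.homogeneousSubmodule (Fin (n + 1)) K m,
        φ.symm a ∈ MvPolynomial.homogeneousSubmodule (Fin (n + 1)) K m) ∧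
      φ 1 = 1 ∧
      ∀ m : ℕ, ∀ a ∈ MvPolynomial.homogeneousSubmodule (Fin (n + 1)) K m,
        ∀ b : MvPolynomial (Fin (n + 1)) K,
          φ (a * (glAut K n σ ^ m) b) = φ a * (glAut K n σ' ^ m) (φ b)) ↔
    (∃ (ρ : GL (Fin (n + 1)) K) (c : Kˣ),
      ((ρ * σ * ρ⁻¹ : GL (Fin (n + 1)) K) : Matrix (Fin (n + 1)) (Fin (n + 1)) K) =
        (c : K) • (σ' : Matrix (Fin (n + 1)) (Fin (n + 1)) K)) := by
  open TwistAux MvPolynomial Matrix in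
  constructor
  · rintro ⟨φ, h1, h2, -, h4⟩
    simp only [mem_homogeneousSubmodule, glAut_eq] at h1 h2 h4
    choose F hF using fun i => exists_lin (h1 1 (X i) (isHomogeneous_X K i))
    choose G hG using fun i => exists_lin (h2 1 (X i) (isHomogeneous_X K i))
    have hF' := linear_lin (f := φ.toLinearMap) (F := Matrix.of F) hF
    have hG' := linear_lin (f := φ.symm.toLinearMap) (F := Matrix.of G) hG
    simp only [LinearEquiv.coe_coe] at hF' hG'
    set F₀ : Matrix (Fin (n + 1)) (Fin (n + 1)) K := Matrix.of F
    set G₀ : Matrix (Fin (n + 1)) (Fin (n + 1)) K := Matrix.of G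
    have hFG : F₀ * G₀ = 1 := by
      apply Matrix.ext_of_single_vecMul
      intro i
      apply lin_inj
      rw [← Matrix.vecMul_vecMul, ← hG', ← hF', LinearEquiv.symm_apply_apply, Matrix.vecMul_one]
    have hGF : G₀ * F₀ = 1 := mul_eq_one_comm.1 hFG
    set s : Matrix (Fin (n + 1)) (Fin (n + 1)) K := (σ : Matrix (Fin (n + 1)) (Fin (n + 1)) K)
    set s' : Matrix (Fin (n + 1)) (Fin (n + 1)) K := (σ' : Matrix (Fin (n + 1)) (Fin (n + 1)) K)
    set r : Matrix (Fin (n + 1)) (Fin (n + 1)) K :=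
      ((σ⁻¹ : GL (Fin (n + 1)) K) : Matrix (Fin (n + 1)) (Fin (n + 1)) K)
    have hrs : r * s = 1 := σ.inv_mul
    have hsr : s * r = 1 := σ.mul_inv
    have key : ∀ x y : Fin (n + 1) → K,
        φ (lin (x ᵥ* G₀) * lin (y ᵥ* G₀)) = lin x * lin (y ᵥ* (G₀ * r * F₀ * s')) := by
      intro x y
      have := h4 1 (lin (x ᵥ* G₀)) (lin_hom _) (lin (y ᵥ* (G₀ * r)))
      rw [pow_one, pow_one, mAut_lin, hF', hF', mAut_lin] at this
      simpa only [Matrix.vecMul_vecMul, Matrix.mul_assoc, hrs, hGF, Matrix.mul_one,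
        Matrix.vecMul_one] using this
    have hH := scalar_of_comm (H := G₀ * r * F₀ * s') (fun x y => by
      rw [← key, ← key, mul_comm])
    set c := (G₀ * r * F₀ * s') 0 0
    have hrel : F₀ * s' = c • (s * F₀) := by
      calc F₀ * s' = (s * ((F₀ * G₀) * r)) * F₀ * s' := by
            rw [hFG, Matrix.one_mul, hsr, Matrix.one_mul]
        _ = s * F₀ * (G₀ * r * F₀ * s') := by simp only [Matrix.mul_assoc]
        _ = c • (s * F₀) := by rw [hH]; simp
    have hs' : s' = c • (G₀ * s * F₀) := by
      calc s' = G₀ * (F₀ * s') := by rw [← Matrix.mul_assoc, hGF, Matrix.one_mul]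
        _ = _ := by rw [hrel]; simp [Matrix.mul_assoc]
    have hc : c ≠ 0 := by
      intro hc
      rw [hc, zero_smul] at hs'
      exact σ'.ne_zero hs'
    refine ⟨⟨G₀, F₀, hGF, hFG⟩, (Units.mk0 c hc)⁻¹, ?_⟩
    change G₀ * s * F₀ = c⁻¹ • s'
    rw [hs', smul_smul, inv_mul_cancel₀ hc, one_smul]
  · rintro ⟨ρ, c, h⟩
    set P : Matrix (Fin (n + 1)) (Fin (n + 1)) K := (ρ : Matrix (Fin (n + 1)) (Fin (n + 1)) K)
    set F : Matrix (Fin (n + 1)) (Fin (n + 1)) K :=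
      ((ρ⁻¹ : GL (Fin (n + 1)) K) : Matrix (Fin (n + 1)) (Fin (n + 1)) K)
    have hFP : F * P = 1 := ρ.inv_mul
    have hPF : P * F = 1 := ρ.mul_inv
    set s : Matrix (Fin (n + 1)) (Fin (n + 1)) K := (σ : Matrix (Fin (n + 1)) (Fin (n + 1)) K)
    set s' : Matrix (Fin (n + 1)) (Fin (n + 1)) K := (σ' : Matrix (Fin (n + 1)) (Fin (n + 1)) K)
    change P * s * F = (c : K) • s' at h
    have hrel : s * F = (c : K) • (F * s') := by
      rw [← Matrix.mul_smul, ← h, ← Matrix.mul_assoc, ← Matrix.mul_assoc, hFP, Matrix.one_mul]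
    let t : ℕ → Kˣ := fun m => (c ^ (m.choose 2))⁻¹
    have happ : ∀ b, ((mEquiv F P hFP hPF).trans (scal t)) b = scal t (mAut F b) := fun b => rfl
    have happ' : ∀ b, ((mEquiv F P hFP hPF).trans (scal t)).symm b = mAut P ((scal t).symm b) :=
      fun b => rfl
    refine ⟨(mEquiv F P hFP hPF).trans (scal t), ?_, ?_, ?_, ?_⟩
    · intro m a ha
      rw [happ, scal_hom t (mAut_hom F ha)]
      exact Submodule.smul_mem _ _ (mAut_hom F ha)
    · intro m a ha
      rw [happ', scal_symm_hom t ha, map_smul]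
      exact Submodule.smul_mem _ _ (mAut_hom P ha)
    · rw [happ, map_one, scal_hom t (isHomogeneous_one _ _)]
      simp [t]
    · intro m a ha b
      rw [glAut_eq, glAut_eq]
      induction b using MvPolynomial.induction_on' with
      | monomial u r =>
        have hb : (monomial u r).IsHomogeneous u.degree := isHomogeneous_monomial r rfl
        generalize (monomial u r : MvPolynomial (Fin (n + 1)) K) = b at hb
        generalize u.degree = l at hb
        have hSm : ∀ (M : Matrix (Fin (n + 1)) (Fin (n + 1)) K) (k : ℕ)
            (q : MvPolynomial (Fin (n + 1)) K), q.IsHomogeneous l →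
            ((mAut M ^ k) q).IsHomogeneous l := by
          intro M k
          induction k with
          | zero => intro q hq; simpa using hq
          | succ k ih =>
            intro q hq
            rw [pow_succ, AlgHom.mul_apply]
            exact ih _ (mAut_hom M hq)
        rw [happ, happ, happ, scal_hom t (mAut_hom F (ha.mul (hSm s m b hb))),
          scal_hom t (mAut_hom F ha), scal_hom t (mAut_hom F hb), map_mul,
          pow_comm_rel hrel m hb, map_smul, mul_smul_comm, smul_mul_smul_comm, smul_smul]
        congr 1
        simp only [t, choose_two, Units.val_inv_eq_inv_val, Units.val_pow_eq_pow_val, Units.val_mul, pow_add]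
        have := c.ne_zero
        field_simp
      | add p q hp hq => simp only [map_add, mul_add, hp, hq]
end

section
/- Let k be an algebraically closed field of characteristic 0, let n ≥ 0, and let A = k[x₀,…,x_n] be the polynomial ring with its standard grading. Then for every twisting system τ on A, there exists σ ∈ GL_{n+1}(k), acting as a graded algebra automorphism of A, such that A^τ is isomorphic as a graded k-algebra to the twist A^σ of A by σ (the twisted algebra for the algebraic twisting system {σ^m : m ∈ ℕ}). In other words, every Zhang twist of the polynomial ring is, up to graded algebra isomorphism, a twist by a graded algebra automorphism. -/
namespace ZhangAux
open MvPolynomial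

variable {K : Type*} [Field K] {n : ℕ}

lemma linear_eq {p : MvPolynomial (Fin (n + 1)) K} (hp : p.IsHomogeneous 1) :
    p = ∑ j, coeff (Finsupp.single j 1) p • X j := by
  classical
  ext d
  simp only [coeff_sum, coeff_smul, coeff_X, smul_eq_mul, mul_ite, mul_one, mul_zero]
  by_cases hd : d.degree = 1
  · obtain ⟨i, rfl⟩ : ∃ i, d = Finsupp.single i 1 := by
      obtain ⟨i, hi⟩ : ∃ i, d i ≠ 0 := by
        by_contra! hz
        have : d = 0 := by ext i; simp [hz i]
        simp [this] at hd
      have hle : Finsupp.single i 1 ≤ d := by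
        rw [Finsupp.single_le_iff]; omega
      have hd2 : d = Finsupp.single i 1 + (d - Finsupp.single i 1) :=
        (add_tsub_cancel_of_le hle).symm
      have := congrArg Finsupp.degree hd2
      rw [map_add, hd, Finsupp.degree_single] at this
      have h0 : (d - Finsupp.single i 1).degree = 0 := by omega
      rw [Finsupp.degree_eq_zero_iff] at h0
      rw [h0, add_zero] at hd2
      exact ⟨i, hd2⟩
    simp [Finsupp.single_left_inj]
  · rw [hp.coeff_eq_zero hd]
    symm
    apply Finset.sum_eq_zero
    intro j _
    rw [if_neg]
    rintro rfl
    simp at hd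

/-- Induction principle: homogeneous polynomials of degree `l+1` are spanned by `X i * b`. -/
lemma succ_ext {l : ℕ} (f g : MvPolynomial (Fin (n + 1)) K →ₗ[K] MvPolynomial (Fin (n + 1)) K)
    (h : ∀ i, ∀ b : MvPolynomial (Fin (n + 1)) K, b.IsHomogeneous l → f (X i * b) = g (X i * b))
    (p : MvPolynomial (Fin (n + 1)) K) (hp : p.IsHomogeneous (l + 1)) : f p = g p := by
  classical
  rw [p.as_sum, map_sum, map_sum]
  apply Finset.sum_congr rfl
  intro d hd
  have hdeg : d.degree = l + 1 := by
    by_contra hne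
    exact (mem_support_iff.1 hd) (hp.coeff_eq_zero hne)
  obtain ⟨i, hi⟩ : ∃ i, d i ≠ 0 := by
    by_contra! hz
    have : d = 0 := by ext i; simp [hz i]
    simp [this] at hdeg
  have hle : Finsupp.single i 1 ≤ d := by
    rw [Finsupp.single_le_iff]; omega
  have hd2 : d = Finsupp.single i 1 + (d - Finsupp.single i 1) := (add_tsub_cancel_of_le hle).symm
  have hm : monomial d (coeff d p) = X i * monomial (d - Finsupp.single i 1) (coeff d p) := by
    rw [X, monomial_mul, one_mul, ← hd2]
  rw [hm]
  apply h
  apply isHomogeneous_monomial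
  have := congrArg Finsupp.degree hd2
  rw [map_add, hdeg, Finsupp.degree_single] at this
  omega

lemma linear_ext (f g : MvPolynomial (Fin (n + 1)) K →ₗ[K] MvPolynomial (Fin (n + 1)) K)
    (h : ∀ i, f (X i) = g (X i))
    (p : MvPolynomial (Fin (n + 1)) K) (hp : p.IsHomogeneous 1) : f p = g p := by
  rw [linear_eq hp]
  simp [h]

lemma key (h : MvPolynomial (Fin (n + 1)) K ≃ₗ[K] MvPolynomial (Fin (n + 1)) K)
    (hh : ∀ a : MvPolynomial (Fin (n + 1)) K, a.IsHomogeneous 1 → (h a).IsHomogeneous 1)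
    (hc : ∀ i j, X i * h (X j) = X j * h (X i)) :
    ∃ c : K, c ≠ 0 ∧ ∀ a : MvPolynomial (Fin (n + 1)) K, a.IsHomogeneous 1 → h a = c • a := by
  classical
  have off : ∀ i j, j ≠ i → coeff (Finsupp.single j 1) (h (X i)) = 0 := by
    intro i j hij
    have := congrArg (coeff (Finsupp.single j 1 + Finsupp.single j 1)) (hc i j)
    rw [coeff_X_mul, coeff_X_mul'] at this
    rw [← this, if_neg]
    simp [hij]
  have diag : ∀ i, h (X i) = coeff (Finsupp.single i 1) (h (X i)) • X i := by
    intro i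
    conv_lhs => rw [linear_eq (hh _ (isHomogeneous_X K i))]
    rw [Finset.sum_eq_single i]
    · intro j _ hj
      rw [off i j hj, zero_smul]
    · simp
  have same : ∀ i, h (X i) = coeff (Finsupp.single 0 1) (h (X 0)) • X i := by
    intro i
    have h1 := hc 0 i
    rw [diag 0] at h1
    apply mul_left_cancel₀ (X_ne_zero (R := K) (0 : Fin (n + 1)))
    rw [h1, mul_smul_comm, mul_smul_comm, mul_comm]
  refine ⟨coeff (Finsupp.single 0 1) (h (X 0)), ?_, ?_⟩
  · intro h0
    have := same 0
    rw [h0, zero_smul, LinearEquiv.map_eq_zero_iff] at this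
    exact X_ne_zero _ this
  · intro a ha
    exact linear_ext h.toLinearMap (coeff (Finsupp.single 0 1) (h (X 0)) • LinearMap.id)
      (by simpa using same) a ha

/-- Rescaling degree `d` by `f d`. -/
noncomputable def scale (f : ℕ → K) :
    MvPolynomial (Fin (n + 1)) K →ₗ[K] MvPolynomial (Fin (n + 1)) K :=
  (basisMonomials (Fin (n + 1)) K).constr K (fun d => f d.degree • monomial d 1)

lemma scale_monomial (f : ℕ → K) (d : Fin (n + 1) →₀ ℕ) (r : K) :
    scale f (monomial d r) = f d.degree • monomial d r := by
  have h1 : scale f (monomial d (1 : K)) = f d.degree • monomial d 1 := by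
    have := (basisMonomials (Fin (n + 1)) K).constr_basis K
      (fun d => f d.degree • monomial d (1 : K)) d
    rwa [coe_basisMonomials] at this
  have h2 : monomial d r = r • monomial d (1 : K) := by rw [smul_monomial]; simp
  rw [h2, map_smul, h1, smul_comm]

lemma scale_hom (f : ℕ → K) {l : ℕ} (p : MvPolynomial (Fin (n + 1)) K) (hp : p.IsHomogeneous l) :
    scale f p = f l • p := by
  conv_lhs => rw [p.as_sum, map_sum]
  conv_rhs => rw [p.as_sum, Finset.smul_sum]
  apply Finset.sum_congr rfl
  intro d hd
  have hdeg : d.degree = l := by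
    by_contra hne
    exact (mem_support_iff.1 hd) (hp.coeff_eq_zero hne)
  rw [scale_monomial, hdeg]

lemma scale_scale (f g : ℕ → K) (h : ∀ d, f d * g d = 1) :
    (scale f : MvPolynomial (Fin (n + 1)) K →ₗ[K] _) ∘ₗ scale g = LinearMap.id := by
  refine (basisMonomials (Fin (n + 1)) K).ext fun d => ?_
  simp only [coe_basisMonomials, LinearMap.comp_apply, scale_monomial, map_smul, smul_smul,
    LinearMap.id_apply]
  rw [mul_comm, h, one_smul]

noncomputable def scaleEquiv (f : ℕ → K) (hf : ∀ d, f d ≠ 0) :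
    MvPolynomial (Fin (n + 1)) K ≃ₗ[K] MvPolynomial (Fin (n + 1)) K :=
  LinearEquiv.ofLinearMap (scale f) (scale fun d => (f d)⁻¹)
    (scale_scale _ _ fun d => mul_inv_cancel₀ (hf d))
    (scale_scale _ _ fun d => inv_mul_cancel₀ (hf d))

lemma scaleEquiv_hom (f : ℕ → K) (hf : ∀ d, f d ≠ 0) {l : ℕ}
    (p : MvPolynomial (Fin (n + 1)) K) (hp : p.IsHomogeneous l) :
    scaleEquiv f hf p = f l • p := scale_hom f p hp

lemma scaleEquiv_symm_hom (f : ℕ → K) (hf : ∀ d, f d ≠ 0) {l : ℕ}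
    (p : MvPolynomial (Fin (n + 1)) K) (hp : p.IsHomogeneous l) :
    (scaleEquiv f hf).symm p = (f l)⁻¹ • p := scale_hom (fun d => (f d)⁻¹) p hp

lemma smul_cancel {p : MvPolynomial (Fin (n + 1)) K} (hp : p ≠ 0) {r s : K}
    (h : r • p = s • p) : r = s := smul_left_injective K hp h

lemma cocycle (c : ℕ → ℕ → K) (hc0 : ∀ l m, c l m ≠ 0)
    (hcoc : ∀ m p l, c (p + l) m * c l p = c p m * c l (m + p)) :
    ∃ f : ℕ → K, f 0 = c 0 0 ∧ (∀ m, f m ≠ 0) ∧ ∀ l m, f (m + l) * c l m = f m * f l := by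
  let f : ℕ → K := fun m => Nat.rec (c 0 0) (fun m r => r / c 1 m) m
  have hf0 : f 0 = c 0 0 := rfl
  have hfsucc : ∀ m, f (m + 1) * c 1 m = f m := by
    intro m
    exact div_mul_cancel₀ _ (hc0 _ _)
  have hfne : ∀ m, f m ≠ 0 := by
    intro m
    induction m with
    | zero => exact hc0 0 0
    | succ m ih =>
      intro h0
      rw [← hfsucc, h0, zero_mul] at ih
      exact ih rfl
  have hfc : ∀ l m, f (m + l) * c l m = f m * f l := by
    intro l m
    induction l with
    | zero =>
      have := hcoc m 0 0
      simp only [add_zero] at this ⊢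
      rw [hf0, mul_left_cancel₀ (hc0 0 m) this]
    | succ l ih =>
      have h1 := hcoc m l 1
      have h2 := hfsucc (m + l)
      have h3 := hfsucc l
      apply mul_right_cancel₀ (hc0 1 l)
      rw [mul_assoc, h1, mul_assoc, h3, ← ih, ← h2]
      rw [← add_assoc]
      ring
  exact ⟨f, hf0, hfne, hfc⟩

end ZhangAux



/-- Every Zhang twist of the polynomial ring `A = K[x₀,…,x_n]` is, up to graded algebra
isomorphism, a twist by a graded algebra automorphism: for every twisting system `τ` on
`A` there is `σ ∈ GL_{n+1}(K)` and a degree-preserving linear equivalence `φ` of `A`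
sending the identity `τ₀⁻¹(1)` of `A^τ` to the identity `1` of `A^σ` and satisfying
`φ(a ⋆_τ b) = φ(a) ⋆_σ φ(b)`, i.e. `φ(a·τ_m(b)) = φ(a)·σ^m(φ(b))` for homogeneous `a`
of degree `m`. -/
theorem polynomial_twist_is_algebraic
    (K : Type*) [Field K] [IsAlgClosed K] [CharZero K] (n : ℕ)
    (τ : TwistingSystem K (MvPolynomial.homogeneousSubmodule (Fin (n + 1)) K)) :
    ∃ (σ : GL (Fin (n + 1)) K)
      (φ : MvPolynomial (Fin (n + 1)) K ≃ₗ[K] MvPolynomial (Fin (n + 1)) K),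
      (∀ m : ℕ, ∀ a ∈ MvPolynomial.homogeneousSubmodule (Fin (n + 1)) K m,
        φ a ∈ MvPolynomial.homogeneousSubmodule (Fin (n + 1)) K m) ∧
      (∀ m : ℕ, ∀ a ∈ MvPolynomial.homogeneousSubmodule (Fin (n + 1)) K m,
        φ.symm a ∈ MvPolynomial.homogeneousSubmodule (Fin (n + 1)) K m) ∧
      φ ((τ.toFun 0).symm 1) = 1 ∧
      ∀ m : ℕ, ∀ a ∈ MvPolynomial.homogeneousSubmodule (Fin (n + 1)) K m,
        ∀ b : MvPolynomial (Fin (n + 1)) K,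
          φ (a * τ.toFun m b) = φ a * (glAut K n σ ^ m) (φ b) := by
  classical
  have hmem : ∀ m l (a : MvPolynomial (Fin (n + 1)) K), a.IsHomogeneous l →
      (τ.toFun m a).IsHomogeneous l := fun m l a ha => τ.map_mem m l a ha
  have hmem' : ∀ m l (a : MvPolynomial (Fin (n + 1)) K), a.IsHomogeneous l →
      ((τ.toFun m).symm a).IsHomogeneous l := fun m l a ha => τ.symm_map_mem m l a ha
  have htw : ∀ m l (a b : MvPolynomial (Fin (n + 1)) K), a.IsHomogeneous l →
      τ.toFun m (a * b) = τ.toFun m a * τ.toFun (m + l) ((τ.toFun l).symm b) :=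
    fun m l a b ha => τ.twist m l a b ha
  obtain ⟨σ, hσ⟩ : ∃ σ : GL (Fin (n + 1)) K, ∀ i,
      glAut K n σ (MvPolynomial.X i) = τ.toFun 1 (MvPolynomial.X i) := by
    -- the matrix
    let M : Matrix (Fin (n + 1)) (Fin (n + 1)) K := fun i j =>
      MvPolynomial.coeff (Finsupp.single j 1) (τ.toFun 1 (MvPolynomial.X i))
    let M' : Matrix (Fin (n + 1)) (Fin (n + 1)) K := fun i j =>
      MvPolynomial.coeff (Finsupp.single j 1) ((τ.toFun 1).symm (MvPolynomial.X i))
    have hM : ∀ i, τ.toFun 1 (MvPolynomial.X i) = ∑ j, M i j • MvPolynomial.X j := fun i =>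
      ZhangAux.linear_eq (hmem 1 1 _ (MvPolynomial.isHomogeneous_X K i))
    have hMM : M * M' = 1 := by
      ext i k
      have h1 : (τ.toFun 1).symm (τ.toFun 1 (MvPolynomial.X i)) = MvPolynomial.X i := by simp
      rw [hM, map_sum] at h1
      have h2 := congrArg (MvPolynomial.coeff (Finsupp.single k 1)) h1
      rw [MvPolynomial.coeff_sum] at h2
      simp only [map_smul, MvPolynomial.coeff_smul, smul_eq_mul, MvPolynomial.coeff_X,
        Finsupp.single_left_inj one_ne_zero] at h2
      rw [Matrix.mul_apply, Matrix.one_apply]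
      exact h2
    let σ : GL (Fin (n + 1)) K := ⟨M, M', hMM, mul_eq_one_comm.1 hMM⟩
    refine ⟨σ, fun i => ?_⟩
    rw [hM, glAut, MvPolynomial.aeval_X]
  obtain ⟨S, hS⟩ : ∃ S, S = glAut K n σ := ⟨_, rfl⟩
  have hSX : ∀ i, S (MvPolynomial.X i) = τ.toFun 1 (MvPolynomial.X i) := by
    intro i
    rw [hS, hσ]
  have hS1 : ∀ a : MvPolynomial (Fin (n + 1)) K, a.IsHomogeneous 1 → S a = τ.toFun 1 a := by
    intro a ha
    exact ZhangAux.linear_ext S.toLinearMap (τ.toFun 1).toLinearMap (by simpa using hSX) a ha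
  -- comparison on linear forms
  have hstep : ∀ m, ∃ c : K, c ≠ 0 ∧ ∀ a : MvPolynomial (Fin (n + 1)) K, a.IsHomogeneous 1 →
      τ.toFun (m + 1) a = c • τ.toFun m (S a) := by
    intro m
    obtain ⟨c, hc0, hc⟩ := ZhangAux.key
      ((τ.toFun m).symm.trans ((τ.toFun 1).symm.trans (τ.toFun (m + 1))))
      (fun a ha => hmem _ _ _ (hmem' _ _ _ (hmem' _ _ _ ha))) (by
        intro i j
        have e1 := htw m 1 _ ((τ.toFun m).symm (MvPolynomial.X j))
          (hmem' m 1 _ (MvPolynomial.isHomogeneous_X K i))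
        have e2 := htw m 1 _ ((τ.toFun m).symm (MvPolynomial.X i))
          (hmem' m 1 _ (MvPolynomial.isHomogeneous_X K j))
        rw [mul_comm, e2] at e1
        simpa using e1.symm)
    refine ⟨c, hc0, fun a ha => ?_⟩
    have := hc (τ.toFun m (τ.toFun 1 a)) (hmem _ _ _ (hmem _ _ _ ha))
    rw [hS1 a ha]
    simpa using this
  have hlin : ∀ m, ∃ c : K, c ≠ 0 ∧ ∀ a : MvPolynomial (Fin (n + 1)) K, a.IsHomogeneous 1 →
      τ.toFun m a = c • (S ^ m) a := by
    intro m
    induction m with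
    | zero =>
      obtain ⟨c, hc0, hc⟩ := hstep 0
      refine ⟨c⁻¹, inv_ne_zero hc0, fun a ha => ?_⟩
      have ha' := hmem' 1 1 a ha
      have := hc _ ha'
      rw [hS1 _ ha'] at this
      simp only [zero_add, LinearEquiv.apply_symm_apply] at this
      simp only [pow_zero, AlgHom.one_apply]
      conv_rhs => rw [this]
      rw [smul_smul, inv_mul_cancel₀ hc0, one_smul]
    | succ m ih =>
      obtain ⟨c, hc0, hc⟩ := hstep m
      obtain ⟨c', hc0', hc'⟩ := ih
      refine ⟨c * c', mul_ne_zero hc0 hc0', fun a ha => ?_⟩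
      have hSa : (S a).IsHomogeneous 1 := by rw [hS1 a ha]; exact hmem _ _ _ ha
      rw [hc a ha, hc' _ hSa, smul_smul, pow_succ, AlgHom.mul_apply]
  have hall : ∀ l m, ∃ c : K, c ≠ 0 ∧ ∀ a : MvPolynomial (Fin (n + 1)) K, a.IsHomogeneous l →
      τ.toFun m a = c • (S ^ m) a := by
    intro l
    induction l with
    | zero =>
      intro m
      have hform : ∀ a : MvPolynomial (Fin (n + 1)) K, a.IsHomogeneous 0 →
          a = MvPolynomial.C (MvPolynomial.coeff 0 a) := fun a ha =>
        MvPolynomial.totalDegree_eq_zero_iff_eq_C.1 (Nat.le_zero.1 ha.totalDegree_le)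
      have h1 := hform _ (hmem m 0 1 (MvPolynomial.isHomogeneous_one _ _))
      refine ⟨MvPolynomial.coeff 0 (τ.toFun m 1), ?_, ?_⟩
      · intro h0
        rw [h0, map_zero, LinearEquiv.map_eq_zero_iff] at h1
        exact one_ne_zero h1
      · intro a ha
        have h2 : a = MvPolynomial.coeff 0 a • 1 := by
          conv_lhs => rw [hform a ha]
          rw [MvPolynomial.smul_eq_C_mul, mul_one]
        generalize MvPolynomial.coeff 0 a = r at h2
        generalize MvPolynomial.coeff 0 (τ.toFun m 1) = t at h1
        rw [h2, map_smul, map_smul, map_one (S ^ m), h1, smul_comm t r, MvPolynomial.smul_eq_C_mul 1 t,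
          mul_one]
    | succ l ih =>
      intro m
      obtain ⟨c1, hc1, e1⟩ := hlin m
      obtain ⟨c2, hc2, e2⟩ := ih (m + 1)
      obtain ⟨c3, hc3, e3⟩ := ih 1
      refine ⟨c1 * (c2 * c3⁻¹), mul_ne_zero hc1 (mul_ne_zero hc2 (inv_ne_zero hc3)), ?_⟩
      intro a ha
      refine ZhangAux.succ_ext (τ.toFun m).toLinearMap
        ((c1 * (c2 * c3⁻¹)) • (S ^ m).toLinearMap) ?_ a ha
      intro i b hb
      have hX := MvPolynomial.isHomogeneous_X K i
      have hb' := hmem' 1 l b hb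
      have e4 : S ((τ.toFun 1).symm b) = c3⁻¹ • b := by
        have := e3 _ hb'
        rw [LinearEquiv.apply_symm_apply, pow_one] at this
        conv_rhs => rw [this]
        rw [smul_smul, inv_mul_cancel₀ hc3, one_smul]
      have e5 := htw m 1 _ b hX
      rw [e1 _ hX, e2 _ hb', pow_succ, AlgHom.mul_apply, e4] at e5
      simp only [LinearEquiv.coe_coe, LinearMap.smul_apply, AlgHom.toLinearMap_apply, map_mul]
      rw [e5, map_smul, smul_smul, smul_mul_smul_comm]
  choose c hc0 hc using hall
  have hSne : ∀ m l (a : MvPolynomial (Fin (n + 1)) K), a.IsHomogeneous l → a ≠ 0 →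
      (S ^ m) a ≠ 0 := by
    intro m l a ha hne h0
    have := hc l m a ha
    rw [h0, smul_zero, LinearEquiv.map_eq_zero_iff] at this
    exact hne this
  have hcoc : ∀ m p l, c (p + l) m * c l p = c p m * c l (m + p) := by
    intro m p l
    have hXp : ∀ q, ((MvPolynomial.X 0 : MvPolynomial (Fin (n + 1)) K) ^ q).IsHomogeneous q :=
      fun q => by simpa using (MvPolynomial.isHomogeneous_X K (0 : Fin (n + 1))).pow q
    have hXne : ∀ q, (MvPolynomial.X 0 : MvPolynomial (Fin (n + 1)) K) ^ q ≠ 0 :=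
      fun q => pow_ne_zero _ (MvPolynomial.X_ne_zero _)
    have h1 := htw m p _ (τ.toFun p (MvPolynomial.X 0 ^ l)) (hXp p)
    rw [hc (p + l) m _ ((hXp p).mul (hmem p l _ (hXp l))), LinearEquiv.symm_apply_apply,
      hc p m _ (hXp p), hc l (m + p) _ (hXp l), hc l p _ (hXp l), mul_smul_comm, map_smul,
      smul_smul, map_mul, ← AlgHom.mul_apply, ← pow_add, smul_mul_smul_comm] at h1
    exact ZhangAux.smul_cancel
      (mul_ne_zero (hSne m p _ (hXp p) (hXne p)) (hSne (m + p) l _ (hXp l) (hXne l))) h1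
  -- trivialise the cocycle
  obtain ⟨f, hf0, hfne, hfc⟩ := ZhangAux.cocycle c hc0 hcoc
  have hφ : ∀ l (a : MvPolynomial (Fin (n + 1)) K), a.IsHomogeneous l →
      ZhangAux.scaleEquiv f hfne a = f l • a :=
    fun l a ha => ZhangAux.scaleEquiv_hom f hfne a ha
  have hφ' : ∀ l (a : MvPolynomial (Fin (n + 1)) K), a.IsHomogeneous l →
      (ZhangAux.scaleEquiv f hfne).symm a = (f l)⁻¹ • a :=
    fun l a ha => ZhangAux.scaleEquiv_symm_hom f hfne a ha
  refine ⟨σ, ZhangAux.scaleEquiv f hfne, ?_, ?_, ?_, ?_⟩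
  all_goals try rw [← hS]
  · intro m a ha
    rw [hφ m a ha]
    exact Submodule.smul_mem _ _ ha
  · intro m a ha
    rw [hφ' m a ha]
    exact Submodule.smul_mem _ _ ha
  · have h1 := hmem' 0 0 1 (MvPolynomial.isHomogeneous_one _ _)
    have h2 := hc 0 0 _ h1
    rw [LinearEquiv.apply_symm_apply, pow_zero, AlgHom.one_apply] at h2
    rw [hφ 0 _ h1, hf0, ← h2]
  · intro m a ha b
    have ha' : a.IsHomogeneous m := ha
    induction b using MvPolynomial.induction_on' with
    | monomial d r =>
      have hb : (MvPolynomial.monomial d r).IsHomogeneous d.degree :=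
        MvPolynomial.isHomogeneous_monomial r rfl
      rw [hφ _ _ (ha'.mul (hmem m _ _ hb)), hφ _ _ ha', hφ _ _ hb, hc _ _ _ hb, map_smul,
        mul_smul_comm, smul_smul, smul_mul_smul_comm, hfc]
    | add p q hp hq =>
      simp only [map_add, mul_add, hp, hq]
end

section
/- Let k be an algebraically closed field of characteristic 0 and let α, β, γ ∈ k^× with αβγ ≠ 1. Let E ⊂ ℙ²(k) be the union of the three coordinate lines ℓ₁ = {a = 0}, ℓ₂ = {b = 0}, ℓ₃ = {c = 0}, and let μ(α,β,γ) : E → E be defined by μ|_{ℓ₁}(0:b:c) = (0:αb:c), μ|_{ℓ₂}(a:0:c) = (a:0:βc), μ|_{ℓ₃}(a:b:0) = (γa:b:0). Then the subset of ℙ²(k) × ℙ²(k) consisting of pairs ((a:b:c),(a':b':c')) satisfying the three bihomogeneous equations c·b' = α·b·c', a·c' = β·c·a', b·a' = γ·a·b' is exactly the graph {(p, μ(α,β,γ)(p)) : p ∈ E}. -/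
open scoped Classical

/-- The subset of ℙ²(k) × ℙ²(k) cut out by the three multilinearized relations
`c·b' = α·b·c'`, `a·c' = β·c·a'`, `b·a' = γ·a·b'` of `O_{(α,β,γ)}(ℙ²)` is exactly the
graph `{(p, μ(α,β,γ)(p)) : p ∈ E}`, where `E` is the union of the three coordinate
lines.  Points of ℙ²(k) are described by nonzero homogeneous coordinate vectors
`u = (a,b,c)` and `w = (a',b',c')`, equality of points meaning proportionality by a
nonzero scalar. -/
theorem point_scheme_graph (k : Type*) [Field k] [IsAlgClosed k] [CharZero k]
    (α β γ : k) (hα : α ≠ 0) (hβ : β ≠ 0) (hγ : γ ≠ 0) (h1 : α * β * γ ≠ 1) :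
    ∀ u w : Fin 3 → k, u ≠ 0 → w ≠ 0 →
      ((u 2 * w 1 = α * (u 1 * w 2) ∧ u 0 * w 2 = β * (u 2 * w 0) ∧
          u 1 * w 0 = γ * (u 0 * w 1)) ↔
        (memTriangle u ∧ ∃ c : k, c ≠ 0 ∧ w = c • muVec α β γ u)) := by
  intro u w hu hw
  have hu' : ¬ (u 0 = 0 ∧ u 1 = 0 ∧ u 2 = 0) := by
    rintro ⟨h0, h1, h2⟩
    exact hu (by ext i; fin_cases i <;> simp [h0, h1, h2])
  have hw' : ¬ (w 0 = 0 ∧ w 1 = 0 ∧ w 2 = 0) := by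
    rintro ⟨h0, h1, h2⟩
    exact hw (by ext i; fin_cases i <;> simp [h0, h1, h2])
  have key : ∀ (c : k) (v : Fin 3 → k),
      w = c • v ↔ (w 0 = c * v 0 ∧ w 1 = c * v 1 ∧ w 2 = c * v 2) := by
    intro c v
    constructor
    · intro h
      rw [h]
      simp
    · rintro ⟨h0, h1, h2⟩
      ext i
      fin_cases i <;> simp [h0, h1, h2]
  simp only [key]
  clear key hu hw
  unfold memTriangle muVec
  generalize u 0 = a at *
  generalize u 1 = b at *
  generalize u 2 = c at *
  generalize w 0 = a' at *
  generalize w 1 = b' at *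
  generalize w 2 = c' at *
  constructor
  · rintro ⟨e1, e2, e3⟩
    by_cases ha : a = 0
    · subst ha
      refine ⟨Or.inl rfl, ?_⟩
      have ha' : a' = 0 := by
        by_contra h
        have hc : c = 0 := by simpa [hβ, h] using e2
        have hb : b = 0 := by simpa [h] using e3
        exact hu' ⟨rfl, hb, hc⟩
      subst ha'
      by_cases hc : c = 0
      · subst hc
        have hb : b ≠ 0 := fun h => hu' ⟨rfl, h, rfl⟩
        have hc' : c' = 0 := by simpa [hα, hb] using e1
        subst hc'
        have hb' : b' ≠ 0 := fun h => hw' ⟨rfl, h, rfl⟩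
        refine ⟨b' / (α * b), by simp [*], by simp, ?_, by simp⟩
        simp
        field_simp
      · have hc' : c' ≠ 0 := by
          intro h
          subst h
          have : b' = 0 := by simpa [hc] using e1
          exact hw' ⟨rfl, this, rfl⟩
        refine ⟨c' / c, by simp [*], by simp, ?_, ?_⟩
        · simp
          field_simp
          linear_combination e1
        · simp
          field_simp
    · by_cases hb : b = 0
      · subst hb
        refine ⟨Or.inr (Or.inl rfl), ?_⟩
        have hb' : b' = 0 := by
          simpa [hγ, ha] using e3
        subst hb'
        have ha' : a' ≠ 0 := by
          intro h
          subst h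
          have : c' = 0 := by simpa [ha] using e2
          exact hw' ⟨rfl, rfl, this⟩
        refine ⟨a' / a, by simp [*], ?_, by simp [ha], ?_⟩
        · simp [ha]
        · simp [ha]
          field_simp
          linear_combination e2
      · have hc : c = 0 := by
          by_contra hc
          have h : (1 - α * β * γ) * a' = 0 := by
            have : a * b * c * ((1 - α * β * γ) * a') = 0 := by
              linear_combination a * c * e3 + γ * a * a * e1 + α * γ * a * b * e2
            simpa [ha, hb, hc] using this
          have ha' : a' = 0 := by
            rcases mul_eq_zero.1 h with h | h
            · exact absurd (by linear_combination -h) h1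
            · exact h
          subst ha'
          exact hw' ⟨rfl, by simpa [hγ, ha] using e3, by simpa [ha] using e2⟩
        subst hc
        refine ⟨Or.inr (Or.inr rfl), ?_⟩
        have hc' : c' = 0 := by simpa [ha] using e2
        subst hc'
        have hb' : b' ≠ 0 := by
          intro h
          subst h
          have : a' = 0 := by simpa [hb] using e3
          exact hw' ⟨this, rfl, rfl⟩
        refine ⟨b' / b, by simp [*], ?_, ?_, by simp [ha, hb]⟩
        · simp [ha, hb]
          field_simp
          linear_combination e3
        · simp [ha, hb]
  · rintro ⟨ht, t, -, h⟩
    by_cases ha : a = 0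
    · simp [ha] at h
      obtain ⟨rfl, rfl, rfl⟩ := h
      subst ha
      refine ⟨by ring, by ring, by ring⟩
    · by_cases hb : b = 0
      · simp [ha, hb] at h
        obtain ⟨rfl, rfl, rfl⟩ := h
        subst hb
        refine ⟨by ring, by ring, by ring⟩
      · have hc : c = 0 := by tauto
        simp [ha, hb] at h
        obtain ⟨rfl, rfl, rfl⟩ := h
        subst hc
        refine ⟨by ring, by ring, by ring⟩
end
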